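/- arXiv:1904.06741 — 3 statements merged into one kernel-verified Lean document; each statement's English description precedes it below -/
import Mathlib

section
/- Fix a positive integer l and consider P5 with coefficients α̂ = l²/8, β̂ = −l²/8, γ̂ = 0, δ̂ = −1/2. For any a ∈ ℂ there exists a unique solution y of P5 that is holomorphic in a neighborhood of t = 0 with Taylor expansion y(t) = −1 + Σ_{k=l}^∞ a_k t^k and a_l = a. -/
open Filter Topology Metric

noncomputable section

/-- The fifth Painlevé equation (P5) with coefficients `α, β, γ, δ`, at the point `t`. -/
def P5at (α β γ δ : ℂ) (y : ℂ → ℂ) (t : ℂ) : Prop :=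
  deriv (deriv y) t =
    (1 / (2 * y t) + 1 / (y t - 1)) * (deriv y t) ^ 2 - deriv y t / t +
      (y t - 1) ^ 2 / t ^ 2 * (α * y t + β / y t) + γ * y t / t +
      δ * (y t * (y t + 1) / (y t - 1))

/-- The weighted radial mean `t ↦ ∫₀¹ sⁿ h(st) ds`, which inverts `t d/dt + (n + 1)`. -/
def radialMean (n : ℕ) (h : ℂ → ℂ) (t : ℂ) : ℂ :=
  ∫ s in (0 : ℝ)..1, (s : ℂ) ^ n * h (s * t)

lemma ofReal_mul_mem_ball {r s : ℝ} {t : ℂ} (hs : s ∈ Set.uIcc (0 : ℝ) 1)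
    (ht : t ∈ ball (0 : ℂ) r) : (s : ℂ) * t ∈ ball (0 : ℂ) r := by
  rw [Set.uIcc_of_le zero_le_one] at hs
  rw [mem_ball_zero_iff] at ht ⊢
  rw [norm_mul, Complex.norm_real, Real.norm_of_nonneg hs.1]
  nlinarith [norm_nonneg t, hs.1, hs.2]

lemma continuousOn_radial {r : ℝ} {h : ℂ → ℂ} (hh : ContinuousOn h (ball 0 r)) (n : ℕ) {t : ℂ}
    (ht : t ∈ ball (0 : ℂ) r) :
    ContinuousOn (fun s : ℝ => (s : ℂ) ^ n * h (s * t)) (Set.uIcc 0 1) := by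
  refine ContinuousOn.mul (by fun_prop) (hh.comp (by fun_prop) fun s hs => ?_)
  exact ofReal_mul_mem_ball hs ht

lemma norm_radialMean_le {r M : ℝ} {h : ℂ → ℂ} (hM : ∀ x ∈ ball (0 : ℂ) r, ‖h x‖ ≤ M) (n : ℕ)
    {t : ℂ} (ht : t ∈ ball (0 : ℂ) r) : ‖radialMean n h t‖ ≤ M := by
  have := intervalIntegral.norm_integral_le_of_norm_le_const (a := 0) (b := 1) (C := M)
    (f := fun s : ℝ => (s : ℂ) ^ n * h (s * t)) fun s hs => by
      have h1 := hM _ (ofReal_mul_mem_ball (Set.uIoc_subset_uIcc hs) ht)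
      rw [Set.uIoc_of_le zero_le_one] at hs
      rw [norm_mul, norm_pow, Complex.norm_real, Real.norm_of_nonneg hs.1.le]
      have h2 : s ^ n ≤ 1 := pow_le_one₀ hs.1.le hs.2
      have h3 : 0 ≤ s ^ n := pow_nonneg hs.1.le n
      nlinarith [norm_nonneg (h (s * t))]
  simpa [radialMean] using this

lemma radialMean_sub {r : ℝ} {h₁ h₂ : ℂ → ℂ} (hh₁ : ContinuousOn h₁ (ball 0 r))
    (hh₂ : ContinuousOn h₂ (ball 0 r)) (n : ℕ) {t : ℂ} (ht : t ∈ ball (0 : ℂ) r) :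
    radialMean n h₁ t - radialMean n h₂ t = radialMean n (fun x => h₁ x - h₂ x) t := by
  unfold radialMean
  rw [← intervalIntegral.integral_sub (continuousOn_radial hh₁ n ht).intervalIntegrable
    (continuousOn_radial hh₂ n ht).intervalIntegrable]
  simp only [mul_sub]

lemma hasDerivAt_radialMean {r : ℝ} {h : ℂ → ℂ} (hh : DifferentiableOn ℂ h (ball 0 r)) (n : ℕ)
    {t : ℂ} (ht : t ∈ ball (0 : ℂ) r) :
    HasDerivAt (radialMean n h) (radialMean (n + 1) (deriv h) t) t := by
  have hd : DifferentiableOn ℂ (deriv h) (ball 0 r) := hh.deriv isOpen_ball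
  obtain ⟨ρ, hρ, hρr⟩ := exists_between (mem_ball_zero_iff.mp ht)
  obtain ⟨M, hM⟩ := (isCompact_closedBall (0 : ℂ) ρ).exists_bound_of_continuousOn
    (hd.continuousOn.mono (closedBall_subset_ball hρr))
  have hsub : ball (0 : ℂ) ρ ⊆ ball 0 r := ball_subset_ball hρr.le
  have htρ : t ∈ ball (0 : ℂ) ρ := mem_ball_zero_iff.mpr hρ
  have hmeas {k : ℂ → ℂ} (hk : ContinuousOn k (ball 0 r)) (m : ℕ) {x : ℂ}
      (hx : x ∈ ball (0 : ℂ) r) := (continuousOn_radial hk m hx).intervalIntegrable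
        (μ := MeasureTheory.volume)
  refine (intervalIntegral.hasDerivAt_integral_of_dominated_loc_of_deriv_le
    (F := fun x (s : ℝ) => (s : ℂ) ^ n * h (s * x))
    (F' := fun x (s : ℝ) => (s : ℂ) ^ (n + 1) * deriv h (s * x)) (bound := fun _ => M)
    (isOpen_ball.mem_nhds htρ) ?_ (hmeas hh.continuousOn n ht)
    ?_ ?_ intervalIntegrable_const ?_).2
  · filter_upwards [isOpen_ball.mem_nhds ht] with x hx
    exact (intervalIntegrable_iff.mp (hmeas hh.continuousOn n hx)).aestronglyMeasurable
  · exact (intervalIntegrable_iff.mp (hmeas hd.continuousOn (n + 1) ht)).aestronglyMeasurable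
  · refine .of_forall fun s hs x hx => ?_
    have h1 := hM _ (ball_subset_closedBall (ofReal_mul_mem_ball (Set.uIoc_subset_uIcc hs) hx))
    rw [Set.uIoc_of_le zero_le_one] at hs
    rw [norm_mul, norm_pow, Complex.norm_real, Real.norm_of_nonneg hs.1.le]
    have h2 : s ^ (n + 1) ≤ 1 := pow_le_one₀ hs.1.le hs.2
    have h3 : 0 ≤ s ^ (n + 1) := pow_nonneg hs.1.le _
    nlinarith [norm_nonneg (deriv h (s * x))]
  · refine .of_forall fun s hs x hx => ?_
    have h1 := (hh.differentiableAt (isOpen_ball.mem_nhds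
      (ofReal_mul_mem_ball (Set.uIoc_subset_uIcc hs) (hsub hx)))).hasDerivAt
    have h2 := (h1.comp x ((hasDerivAt_id x).const_mul (s : ℂ))).const_mul ((s : ℂ) ^ n)
    refine h2.congr_deriv ?_
    ring

lemma differentiableOn_radialMean {r : ℝ} {h : ℂ → ℂ} (hh : DifferentiableOn ℂ h (ball 0 r))
    (n : ℕ) : DifferentiableOn ℂ (radialMean n h) (ball 0 r) := fun _ ht =>
  (hasDerivAt_radialMean hh n ht).differentiableAt.differentiableWithinAt

lemma radialMean_ode {r : ℝ} {h : ℂ → ℂ} (hh : DifferentiableOn ℂ h (ball 0 r)) (n : ℕ)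
    {t : ℂ} (ht : t ∈ ball (0 : ℂ) r) :
    t * deriv (radialMean n h) t + (n + 1) * radialMean n h t = h t := by
  have hd : DifferentiableOn ℂ (deriv h) (ball 0 r) := hh.deriv isOpen_ball
  have i1 := (continuousOn_radial hd.continuousOn (n + 1) ht).intervalIntegrable
    (μ := MeasureTheory.volume)
  have i2 := (continuousOn_radial hh.continuousOn n ht).intervalIntegrable
    (μ := MeasureTheory.volume)
  rw [(hasDerivAt_radialMean hh n ht).deriv, radialMean, radialMean,
    ← intervalIntegral.integral_const_mul, ← intervalIntegral.integral_const_mul,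
    ← intervalIntegral.integral_add (i1.const_mul _) (i2.const_mul _),
    intervalIntegral.integral_eq_sub_of_hasDerivAt
      (f := fun s : ℝ => (s : ℂ) ^ (n + 1) * h (s * t)) _ ((i1.const_mul _).add (i2.const_mul _))]
  · simp
  · intro s hs
    have h1 := (hh.differentiableAt (isOpen_ball.mem_nhds (ofReal_mul_mem_ball hs ht))).hasDerivAt
    have h2 : HasDerivAt (fun z : ℂ => z ^ (n + 1) * h (z * t)) _ (s : ℂ) :=
      (hasDerivAt_pow (n + 1) (s : ℂ)).mul (h1.comp (s : ℂ) ((hasDerivAt_id _).mul_const t))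
    refine h2.comp_ofReal.congr_deriv ?_
    push_cast
    ring

/-- A contraction principle for holomorphic functions on an open set. -/
lemma exists_holomorphic_fixedPoint {U : Set ℂ} (hU : IsOpen U) {a : ℂ} {ε : ℝ} (hε : 0 ≤ ε)
    (Φ : (ℂ → ℂ) → ℂ → ℂ)
    (hmaps : ∀ v, DifferentiableOn ℂ v U → (∀ t ∈ U, ‖v t - a‖ ≤ ε) →
      DifferentiableOn ℂ (Φ v) U ∧ ∀ t ∈ U, ‖Φ v t - a‖ ≤ ε)
    (hcontr : ∀ v w, DifferentiableOn ℂ v U → (∀ t ∈ U, ‖v t - a‖ ≤ ε) →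
      DifferentiableOn ℂ w U → (∀ t ∈ U, ‖w t - a‖ ≤ ε) → ∀ M, (∀ t ∈ U, ‖v t - w t‖ ≤ M) →
      ∀ t ∈ U, ‖Φ v t - Φ w t‖ ≤ M / 2) :
    ∃ v, DifferentiableOn ℂ v U ∧ (∀ t ∈ U, ‖v t - a‖ ≤ ε) ∧ ∀ t ∈ U, Φ v t = v t := by
  set u : ℕ → ℂ → ℂ := fun n => Φ^[n] fun _ => a with hu
  have hsucc (n : ℕ) : u (n + 1) = Φ (u n) := Function.iterate_succ_apply' _ _ _
  have hP (n : ℕ) : DifferentiableOn ℂ (u n) U ∧ ∀ t ∈ U, ‖u n t - a‖ ≤ ε := by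
    induction n with
    | zero => simp [hu, hε]
    | succ n ih => rw [hsucc]; exact hmaps _ ih.1 ih.2
  have hstep (n : ℕ) : ∀ t ∈ U, ‖u n t - u (n + 1) t‖ ≤ 2 * ε / 2 / 2 ^ n := by
    induction n with
    | zero =>
      intro t ht
      have := (hP 1).2 t ht
      rw [norm_sub_rev] at this
      simpa [hu] using this
    | succ n ih =>
      intro t ht
      have := hcontr _ _ (hP n).1 (hP n).2 (hP (n + 1)).1 (hP (n + 1)).2 _ ih t ht
      rw [← hsucc, ← hsucc] at this
      refine this.trans_eq ?_
      rw [pow_succ]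
      field_simp
  have hlim : ∀ t, ∃ z, t ∈ U → Tendsto (fun n => u n t) atTop (𝓝 z) := fun t => by
    by_cases ht : t ∈ U
    · obtain ⟨z, hz⟩ := cauchySeq_tendsto_of_complete (cauchySeq_of_le_geometric_two
        (f := fun n => u n t) (C := 2 * ε) fun n => by
          rw [dist_eq_norm]; exact hstep n t ht)
      exact ⟨z, fun _ => hz⟩
    · exact ⟨0, fun h => absurd h ht⟩
  choose v hv using hlim
  have hdist (n : ℕ) : ∀ t ∈ U, ‖u n t - v t‖ ≤ 2 * ε / 2 ^ n := fun t ht => by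
    rw [← dist_eq_norm]
    exact dist_le_of_le_geometric_two_of_tendsto (f := fun n => u n t) (C := 2 * ε) (fun n => by
          rw [dist_eq_norm]; exact hstep n t ht) (hv t ht) n
  have hzero : Tendsto (fun n : ℕ => 2 * ε / (2 : ℝ) ^ n) atTop (𝓝 0) :=
    tendsto_const_nhds.div_atTop (tendsto_pow_atTop_atTop_of_one_lt one_lt_two)
  have hunif : TendstoUniformlyOn u v atTop U := by
    rw [Metric.tendstoUniformlyOn_iff]
    intro δ hδ
    filter_upwards [hzero.eventually_lt_const hδ] with n hn t ht
    rw [dist_comm, dist_eq_norm]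
    exact (hdist n t ht).trans_lt hn
  have hvd : DifferentiableOn ℂ v U := hunif.tendstoLocallyUniformlyOn.differentiableOn
    (.of_forall fun n => (hP n).1) hU
  have hva : ∀ t ∈ U, ‖v t - a‖ ≤ ε := fun t ht =>
    le_of_tendsto ((hv t ht).sub_const a).norm (.of_forall fun n => (hP n).2 t ht)
  refine ⟨v, hvd, hva, fun t ht => ?_⟩
  refine tendsto_nhds_unique (f := fun n => u (n + 1) t) ?_
    ((hv t ht).comp (tendsto_add_atTop_nat 1))
  rw [tendsto_iff_norm_sub_tendsto_zero]
  refine squeeze_zero (fun _ => norm_nonneg _) (fun n => ?_) (by simpa using hzero.div_const 2)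
  rw [hsucc]
  exact hcontr _ _ (hP n).1 (hP n).2 hvd hva _ (hdist n) t ht

/-- Holomorphic solutions of `(t d²/dt² + (n + 1) d/dt) v = K(t, v)` with prescribed value at `0`. -/
lemma exists_singular_ode_solution {K : ℂ × ℂ → ℂ} {a : ℂ} (hK : AnalyticAt ℂ K (0, a)) (n : ℕ) :
    ∃ r > 0, ∃ v : ℂ → ℂ, DifferentiableOn ℂ v (ball 0 r) ∧ v 0 = a ∧
      ∀ t ∈ ball (0 : ℂ) r, t * deriv (deriv v) t + (n + 1) * deriv v t = K (t, v t) := by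
  obtain ⟨L, N, hN, hL⟩ := (hK.contDiffAt (n := 1)).exists_lipschitzOnWith
  obtain ⟨δ, hδ, hball⟩ := Metric.mem_nhds_iff.mp (inter_mem hN hK.eventually_analyticAt)
  have hLip := hL.mono fun p hp => (hball hp).1
  set M : ℝ := ‖K (0, a)‖ + L * δ
  have hM0 : 0 ≤ M := by positivity
  have hmem {t z : ℂ} (ht : ‖t‖ < δ) (hz : ‖z - a‖ ≤ δ / 2) : (t, z) ∈ ball ((0 : ℂ), a) δ := by
    rw [mem_ball, Prod.dist_eq, max_lt_iff, dist_zero_right, dist_eq_norm]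
    exact ⟨ht, hz.trans_lt (half_lt_self hδ)⟩
  have hM : ∀ p ∈ ball ((0 : ℂ), a) δ, ‖K p‖ ≤ M := fun p hp => by
    have h1 := hLip.dist_le_mul p hp _ (mem_ball_self hδ)
    have h2 : (L : ℝ) * dist p (0, a) ≤ L * δ := by gcongr; exact (mem_ball.mp hp).le
    have h3 := norm_sub_norm_le (K p) (K (0, a))
    rw [dist_eq_norm] at h1
    linarith
  set r : ℝ := min δ (min (δ / 2 / (M + 1)) (1 / (2 * (L + 1))))
  have hr : 0 < r := by positivity
  have hrδ : r ≤ δ := min_le_left _ _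
  have hrM : r * M ≤ δ / 2 := by
    have : r ≤ δ / 2 / (M + 1) := (min_le_right _ _).trans (min_le_left _ _)
    rw [le_div_iff₀ (by positivity)] at this
    nlinarith
  have hrL : r * L ≤ 1 / 2 := by
    have : r ≤ 1 / (2 * (L + 1)) := (min_le_right _ _).trans (min_le_right _ _)
    rw [le_div_iff₀ (by positivity)] at this
    nlinarith
  set U := ball (0 : ℂ) r with hU
  have hUδ {t : ℂ} (ht : t ∈ U) : ‖t‖ < δ := (mem_ball_zero_iff.mp ht).trans_le hrδ
  have hKv {v : ℂ → ℂ} (hv : DifferentiableOn ℂ v U) (hva : ∀ t ∈ U, ‖v t - a‖ ≤ δ / 2) :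
      DifferentiableOn ℂ (fun t => K (t, v t)) U := fun t ht => by
    have h1 : DifferentiableAt ℂ K (t, v t) :=
      (hball (hmem (hUδ ht) (hva t ht))).2.differentiableAt
    exact DifferentiableAt.comp_differentiableWithinAt (g := K) t h1
      (differentiableWithinAt_id.prodMk (hv t ht))
  set S : (ℂ → ℂ) → ℂ → ℂ := fun v => radialMean n fun t => K (t, v t) with hS
  have hSd {v : ℂ → ℂ} (hv : DifferentiableOn ℂ v U) (hva : ∀ t ∈ U, ‖v t - a‖ ≤ δ / 2) :
      DifferentiableOn ℂ (S v) U := differentiableOn_radialMean (hKv hv hva) n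
  obtain ⟨v, hv, hva, hfix⟩ : ∃ v : ℂ → ℂ, DifferentiableOn ℂ v U ∧
      (∀ t ∈ U, ‖v t - a‖ ≤ δ / 2) ∧ ∀ t ∈ U, a + t * radialMean 0 (S v) t = v t := by
    refine exists_holomorphic_fixedPoint (U := U) (a := a) isOpen_ball
      (half_pos hδ).le (fun v t => a + t * radialMean 0 (S v) t) (fun v hv hva => ?_)
      (fun v w hv hva hw hwa C hC t ht => ?_)
    · refine ⟨((differentiableOn_id.mul (differentiableOn_radialMean (hSd hv hva) 0)).const_add a),
        fun t ht => ?_⟩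
      have h1 : ∀ x ∈ U, ‖S v x‖ ≤ M := fun x hx =>
        norm_radialMean_le (fun y hy => hM _ (hmem (hUδ hy) (hva y hy))) n hx
      have h2 := norm_radialMean_le h1 0 ht
      have h3 := mem_ball_zero_iff.mp ht
      rw [add_sub_cancel_left, norm_mul]
      nlinarith [norm_nonneg t]
    · have hKL : ∀ x ∈ U, ‖K (x, v x) - K (x, w x)‖ ≤ L * C := fun x hx => by
        have := hLip.dist_le_mul _ (hmem (hUδ hx) (hva x hx)) _ (hmem (hUδ hx) (hwa x hx))
        rw [dist_eq_norm, dist_prod_same_left, dist_eq_norm] at this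
        exact this.trans (by gcongr; exact hC x hx)
      have h1 : ∀ x ∈ U, ‖S v x - S w x‖ ≤ L * C := fun x hx => by
        rw [hS, radialMean_sub (hKv hv hva).continuousOn (hKv hw hwa).continuousOn n hx]
        exact norm_radialMean_le hKL n hx
      have h2 : ‖radialMean 0 (S v) t - radialMean 0 (S w) t‖ ≤ L * C := by
        rw [radialMean_sub (hSd hv hva).continuousOn (hSd hw hwa).continuousOn 0 ht]
        exact norm_radialMean_le h1 0 ht
      have h3 := mem_ball_zero_iff.mp ht
      have hC0 : 0 ≤ C := (norm_nonneg _).trans (hC t ht)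
      rw [add_sub_add_left_eq_sub, ← mul_sub, norm_mul]
      calc _ ≤ r * (L * C) := by gcongr
        _ = r * L * C := by ring
        _ ≤ 1 / 2 * C := by gcongr
        _ = C / 2 := by ring
  refine ⟨r, hr, v, hv, ?_, fun t ht => ?_⟩
  · simpa using (hfix 0 (mem_ball_self hr)).symm
  have hderiv : ∀ t ∈ U, deriv v t = S v t := fun t ht => by
    have h1 : v =ᶠ[𝓝 t] fun t => a + t * radialMean 0 (S v) t := by
      filter_upwards [isOpen_ball.mem_nhds ht] with x hx using (hfix x hx).symm
    have h2 := ((differentiableOn_radialMean (hSd hv hva) 0).differentiableAt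
      (isOpen_ball.mem_nhds ht)).hasDerivAt
    have h3 := ((hasDerivAt_id t).mul h2).const_add a
    have h4 := radialMean_ode (hSd hv hva) 0 ht
    rw [h1.deriv_eq]
    refine h3.deriv.trans ?_
    rw [← h4]
    simp [add_comm]
  have h1 : deriv v =ᶠ[𝓝 t] S v := by
    filter_upwards [isOpen_ball.mem_nhds ht] with x hx using hderiv x hx
  rw [h1.deriv_eq, h1.eq_of_nhds]
  exact radialMean_ode (hKv hv hva) n ht

lemma exists_eq_mul_of_apply_zero {φ : ℂ → ℂ} (hφ : AnalyticAt ℂ φ 0) (h0 : φ 0 = 0) :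
    ∃ ψ, AnalyticAt ℂ ψ 0 ∧ ∀ᶠ z in 𝓝 0, φ z = z * ψ z := by
  have h1 : ((1 : ℕ) : ℕ∞) ≤ analyticOrderAt φ 0 :=
    Order.one_le_iff_ne_zero.mpr (hφ.analyticOrderAt_ne_zero.mpr h0)
  simpa using (natCast_le_analyticOrderAt hφ).mp h1

lemma exists_sin_eq_mul :
    ∃ σ, AnalyticAt ℂ σ 0 ∧ σ 0 = 1 ∧ ∀ᶠ z in 𝓝 0, Complex.sin z = z * σ z := by
  obtain ⟨σ, hσ, hsin⟩ := exists_eq_mul_of_apply_zero (φ := Complex.sin) (by fun_prop) (by simp)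
  refine ⟨σ, hσ, ?_, hsin⟩
  have h1 := (Complex.hasDerivAt_sin 0).congr_of_eventuallyEq (EventuallyEq.symm hsin)
  have h2 := (hasDerivAt_id (0 : ℂ)).mul hσ.differentiableAt.hasDerivAt
  simpa using h2.unique h1

lemma mul_deriv_pow_mul {w : ℂ → ℂ} {t : ℂ} (hw : DifferentiableAt ℂ w t) (m : ℕ) :
    t * deriv (fun x => x ^ m * w x) t = t ^ m * (m * w t + t * deriv w t) := by
  have h : HasDerivAt (fun x => x ^ m * w x) _ t := (hasDerivAt_pow m t).mul hw.hasDerivAt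
  rw [h.deriv]
  cases m with
  | zero => simp
  | succ m => rw [Nat.add_sub_cancel]; ring

lemma euler_sq_pow_mul {w : ℂ → ℂ} {U : Set ℂ} (hU : IsOpen U) (hw : DifferentiableOn ℂ w U)
    {t : ℂ} (ht : t ∈ U) (m : ℕ) :
    t ^ 2 * deriv (deriv fun x => x ^ m * w x) t + t * deriv (fun x => x ^ m * w x) t =
      t ^ m * (m ^ 2 * w t + (2 * m + 1) * t * deriv w t + t ^ 2 * deriv (deriv w) t) := by
  have hwt := hw.differentiableAt (hU.mem_nhds ht)
  have hwt' := (hw.deriv hU).differentiableAt (hU.mem_nhds ht)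
  have hz : DifferentiableOn ℂ (fun x => x ^ m * w x) U := by fun_prop
  have hzt' := (hz.deriv hU).differentiableAt (hU.mem_nhds ht)
  have h1 : (fun x => x * deriv (fun x => x ^ m * w x) x) =ᶠ[𝓝 t]
      fun x => x ^ m * (m * w x + x * deriv w x) := by
    filter_upwards [hU.mem_nhds ht] with x hx
    exact mul_deriv_pow_mul (hw.differentiableAt (hU.mem_nhds hx)) m
  have h2 := ((hasDerivAt_id t).mul hzt'.hasDerivAt).deriv
  have h3 := mul_deriv_pow_mul (w := fun x => m * w x + x * deriv w x) (t := t) (by fun_prop) m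
  have h4 : HasDerivAt (fun x => m * w x + x * deriv w x) _ t :=
    (hwt.hasDerivAt.const_mul (m : ℂ)).add ((hasDerivAt_id t).mul hwt'.hasDerivAt)
  rw [h4.deriv, ← h1.deriv_eq] at h3
  simp only [id] at h2 h3
  have h5 : deriv (fun x => x * deriv (fun x => x ^ m * w x) x) t = _ := h2
  rw [h5] at h3
  linear_combination h3

/-- Holomorphic solutions `z = tˡ v` of
`(t d/dt)² z = l² sin z / cos³ z - t² sin (2z) / 8` with prescribed leading coefficient. -/
lemma exists_trigonometric_ode_solution {l : ℕ} (hl : 0 < l) (b : ℂ) :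
    ∃ r > 0, ∃ v : ℂ → ℂ, DifferentiableOn ℂ v (ball 0 r) ∧ v 0 = b ∧
      ∀ t ∈ ball (0 : ℂ) r, Complex.cos (t ^ l * v t) ≠ 0 ∧
        t ^ 2 * deriv (deriv fun x => x ^ l * v x) t + t * deriv (fun x => x ^ l * v x) t =
          l ^ 2 * (Complex.sin (t ^ l * v t) / Complex.cos (t ^ l * v t) ^ 3) -
            t ^ 2 * Complex.sin (2 * (t ^ l * v t)) / 8 := by
  obtain ⟨σ, hσ, hσ0, hsin⟩ := exists_sin_eq_mul
  obtain ⟨χ, hχ, hsin2⟩ := exists_eq_mul_of_apply_zero (φ := fun z => Complex.sin (2 * z))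
    (by fun_prop) (by simp)
  obtain ⟨ψ, hψ, hcos⟩ := exists_eq_mul_of_apply_zero
    (φ := fun z => σ z / Complex.cos z ^ 3 - 1)
    ((hσ.div (by fun_prop) (by simp)).sub analyticAt_const) (by simp [hσ0])
  have hcos0 : ∀ᶠ z in 𝓝 (0 : ℂ), Complex.cos z ≠ 0 :=
    Complex.continuous_cos.continuousAt.eventually_ne (by simp)
  have hfst : AnalyticAt ℂ (fun p : ℂ × ℂ => p.1) (0, b) := analyticAt_fst
  have hsnd : AnalyticAt ℂ (fun p : ℂ × ℂ => p.2) (0, b) := analyticAt_snd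
  have hz (g : ℂ → ℂ) (hg : AnalyticAt ℂ g 0) :
      AnalyticAt ℂ (fun p : ℂ × ℂ => g (p.1 ^ l * p.2)) (0, b) :=
    AnalyticAt.fun_comp (g := g) (by simpa [hl.ne'] using hg)
      ((hfst.pow l).mul hsnd)
  obtain ⟨r₀, hr₀, v, hv, hv0, hode⟩ := exists_singular_ode_solution (a := b) (n := 2 * l)
    (K := fun p => l ^ 2 * (p.1 ^ (l - 1) * p.2 ^ 2 * ψ (p.1 ^ l * p.2)) -
      p.1 * p.2 * χ (p.1 ^ l * p.2) / 8)
    ((analyticAt_const.mul (((hfst.pow _).mul (hsnd.pow 2)).mul (hz ψ hψ))).sub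
      (((hfst.mul hsnd).mul (hz χ hχ)).div analyticAt_const (by norm_num)))
  have hcont : Tendsto (fun t => t ^ l * v t) (𝓝 0) (𝓝 0) := by
    have h1 := (hv.differentiableAt (ball_mem_nhds 0 hr₀)).continuousAt
    have h2 : ContinuousAt (fun t => t ^ l * v t) 0 := by fun_prop
    simpa [ContinuousAt, hl.ne'] using h2
  obtain ⟨r₁, hr₁, hr₁'⟩ := Metric.eventually_nhds_iff_ball.mp
    (hcont.eventually (hsin.and (hsin2.and (hcos.and hcos0))))
  refine ⟨min r₀ r₁, lt_min hr₀ hr₁, v, hv.mono (ball_subset_ball (min_le_left _ _)), hv0,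
    fun t ht => ?_⟩
  have ht₀ : t ∈ ball (0 : ℂ) r₀ := ball_subset_ball (min_le_left _ _) ht
  obtain ⟨e1, e2, e3, e4⟩ := hr₁' t (ball_subset_ball (min_le_right _ _) ht)
  refine ⟨e4, ?_⟩
  rw [euler_sq_pow_mul isOpen_ball hv ht₀, e2, e1, mul_div_assoc, sub_eq_iff_eq_add.mp e3]
  have h := hode t ht₀
  obtain ⟨k, rfl⟩ := Nat.exists_eq_succ_of_ne_zero hl.ne'
  simp only [Nat.succ_eq_add_one, Nat.add_sub_cancel] at h ⊢
  push_cast at h ⊢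
  linear_combination t ^ (k + 1) * t * h

/-- The substitution `y = (sin z + 1) / (sin z - 1)` removes the squared first derivative from P5. -/
lemma P5at_moebius_sin {l : ℕ} {z : ℂ → ℂ} {U : Set ℂ} (hU : IsOpen U)
    (hz : DifferentiableOn ℂ z U) (hcos : ∀ t ∈ U, Complex.cos (z t) ≠ 0) {t : ℂ} (ht : t ∈ U)
    (ht0 : t ≠ 0)
    (hode : t ^ 2 * deriv (deriv z) t + t * deriv z t =
      l ^ 2 * (Complex.sin (z t) / Complex.cos (z t) ^ 3) - t ^ 2 * Complex.sin (2 * z t) / 8) :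
    P5at ((l : ℂ) ^ 2 / 8) (-(l : ℂ) ^ 2 / 8) 0 (-1 / 2)
      (fun t => (Complex.sin (z t) + 1) / (Complex.sin (z t) - 1)) t := by
  have hs1 : ∀ t ∈ U, Complex.sin (z t) - 1 ≠ 0 := fun t ht h => hcos t ht (by
    have := Complex.sin_sq_add_cos_sq (z t)
    rw [sub_eq_zero.mp h] at this
    simpa using this)
  have hs2 : Complex.sin (z t) + 1 ≠ 0 := fun h => hcos t ht (by
    have := Complex.sin_sq_add_cos_sq (z t)
    rw [eq_neg_of_add_eq_zero_left h] at this
    simpa using this)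
  have hs : ∀ x ∈ U, HasDerivAt (fun t => Complex.sin (z t)) (Complex.cos (z x) * deriv z x) x :=
    fun x hx => (hz.differentiableAt (hU.mem_nhds hx)).hasDerivAt.csin
  have hy : ∀ x ∈ U, deriv (fun t => (Complex.sin (z t) + 1) / (Complex.sin (z t) - 1)) x =
      -2 * (Complex.cos (z x) * deriv z x) / (Complex.sin (z x) - 1) ^ 2 := fun x hx => by
    have : HasDerivAt (fun t => (Complex.sin (z t) + 1) / (Complex.sin (z t) - 1)) _ x :=
      ((hs x hx).add_const 1).div ((hs x hx).sub_const 1) (hs1 x hx)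
    rw [this.deriv]
    ring
  have hy' : deriv (fun t => (Complex.sin (z t) + 1) / (Complex.sin (z t) - 1)) =ᶠ[𝓝 t]
      fun x => -2 * (Complex.cos (z x) * deriv z x) / (Complex.sin (z x) - 1) ^ 2 := by
    filter_upwards [hU.mem_nhds ht] with x hx using hy x hx
  have hyy : HasDerivAt
      (fun x => -2 * (Complex.cos (z x) * deriv z x) / (Complex.sin (z x) - 1) ^ 2) _ t :=
    ((((hz.differentiableAt (hU.mem_nhds ht)).hasDerivAt.ccos).mul
      ((hz.deriv hU).differentiableAt (hU.mem_nhds ht)).hasDerivAt).const_mul (-2)).div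
        (((hs t ht).sub_const 1).pow 2) (pow_ne_zero 2 (hs1 t ht))
  simp only [P5at]
  rw [hy'.deriv_eq, hyy.deriv, hy t ht, Pi.mul_apply]
  have hc := hcos t ht
  have hs1 := hs1 t ht
  have hcs := Complex.sin_sq_add_cos_sq (z t)
  rw [Complex.sin_two_mul] at hode
  generalize Complex.sin (z t) = s at *
  generalize Complex.cos (z t) = c at *
  generalize deriv (deriv z) t = z₂ at *
  generalize deriv z t = z₁ at *
  have hz₂ : z₂ = (l ^ 2 * (s / c ^ 3) - t ^ 2 * (2 * s * c) / 8 - t * z₁) / t ^ 2 := by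
    rw [eq_div_iff (pow_ne_zero 2 ht0)]
    linear_combination hode
  have hs3 : (s + 1) / (s - 1) - 1 = 2 / (s - 1) := by field_simp; ring
  have hc2 : (s - 1) * (s + 1) = -c ^ 2 := by linear_combination hcs
  have hss : -s * z₁ * z₁ + c * z₂ =
      -(l ^ 2 * s / ((s - 1) * (s + 1))) / t ^ 2 + s * ((s - 1) * (s + 1)) / 4 - c * z₁ / t +
        s * (c * z₁) ^ 2 / ((s - 1) * (s + 1)) := by
    rw [hc2, hz₂]
    field_simp
    ring
  rw [hs3, hss]
  generalize c * z₁ = X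
  field_simp
  ring

/-- Two solutions of P5 through `-1` that agree to order `l` at `0` coincide near `0`. -/
lemma eventuallyEq_of_P5at {l : ℕ} {f g : ℂ → ℂ} (hf : AnalyticAt ℂ f 0) (hg : AnalyticAt ℂ g 0)
    (hfP : ∀ᶠ t in 𝓝[≠] 0, P5at ((l : ℂ) ^ 2 / 8) (-(l : ℂ) ^ 2 / 8) 0 (-1 / 2) f t)
    (hgP : ∀ᶠ t in 𝓝[≠] 0, P5at ((l : ℂ) ^ 2 / 8) (-(l : ℂ) ^ 2 / 8) 0 (-1 / 2) g t)
    (hf0 : f 0 = -1) (hg0 : g 0 = -1)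
    (hord : ((l + 1 : ℕ) : ℕ∞) ≤ analyticOrderAt (g - f) 0) : g =ᶠ[𝓝 0] f := by
  by_contra hne
  have htop : analyticOrderAt (g - f) 0 ≠ ⊤ := fun h => hne (by
    filter_upwards [analyticOrderAt_eq_top.mp h] with t ht using sub_eq_zero.mp ht)
  obtain ⟨m, hm⟩ := ENat.ne_top_iff_exists.mp htop
  obtain ⟨h, hh, hh0, hgh⟩ := ((hg.sub hf).analyticOrderAt_eq_natCast).mp hm.symm
  have hlm : l < m := by
    rw [← hm] at hord
    exact_mod_cast hord
  have poly {y : ℂ → ℂ} (hy : AnalyticAt ℂ y 0) (hy0 : y 0 = -1)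
      (hyP : ∀ᶠ t in 𝓝[≠] 0, P5at ((l : ℂ) ^ 2 / 8) (-(l : ℂ) ^ 2 / 8) 0 (-1 / 2) y t) :
      ∀ᶠ t in 𝓝[≠] 0, 2 * y t * (y t - 1) * (t ^ 2 * deriv (deriv y) t + t * deriv y t) =
        (3 * y t - 1) * (t * deriv y t) ^ 2 + l ^ 2 / 4 * ((y t - 1) ^ 4 * (y t + 1)) -
          t ^ 2 * (y t ^ 2 * (y t + 1)) := by
    have n0 : ∀ᶠ t in 𝓝 0, y t ≠ 0 := hy.continuousAt.eventually_ne (by simp [hy0])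
    have n1 : ∀ᶠ t in 𝓝 0, y t ≠ 1 := hy.continuousAt.eventually_ne (by norm_num [hy0])
    filter_upwards [hyP, n0.filter_mono nhdsWithin_le_nhds, n1.filter_mono nhdsWithin_le_nhds,
      self_mem_nhdsWithin] with t e h0 h1 ht
    have h1 : y t - 1 ≠ 0 := sub_ne_zero.mpr h1
    have ht : t ≠ 0 := ht
    rw [P5at] at e
    rw [e]
    field_simp
    ring
  have hgeq : g =ᶠ[𝓝 0] fun t => f t + t ^ m * h t := by
    filter_upwards [hgh] with t ht
    rw [Pi.sub_apply, sub_zero, smul_eq_mul, sub_eq_iff_eq_add'] at ht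
    exact ht
  obtain ⟨ρ, hρ, hρ'⟩ := Metric.eventually_nhds_iff_ball.mp
    (hh.eventually_analyticAt.and hf.eventually_analyticAt)
  have hhd : DifferentiableOn ℂ h (ball 0 ρ) := fun t ht =>
    (hρ' t ht).1.differentiableAt.differentiableWithinAt
  have hfd : DifferentiableOn ℂ f (ball 0 ρ) := fun t ht =>
    (hρ' t ht).2.differentiableAt.differentiableWithinAt
  have hsum (t : ℂ) (ht : t ∈ ball (0 : ℂ) ρ) :
      deriv (fun t => f t + t ^ m * h t) t = deriv f t + deriv (fun t => t ^ m * h t) t :=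
    deriv_fun_add (hfd.differentiableAt (isOpen_ball.mem_nhds ht))
      ((by fun_prop : DifferentiableOn ℂ (fun t => t ^ m * h t) (ball 0 ρ)).differentiableAt
        (isOpen_ball.mem_nhds ht))
  have hsum' (t : ℂ) (ht : t ∈ ball (0 : ℂ) ρ) :
      deriv (deriv fun t => f t + t ^ m * h t) t =
        deriv (deriv f) t + deriv (deriv fun t => t ^ m * h t) t := by
    have e : deriv (fun t => f t + t ^ m * h t) =ᶠ[𝓝 t]
        fun t => deriv f t + deriv (fun t => t ^ m * h t) t := by
      filter_upwards [isOpen_ball.mem_nhds ht] with x hx using hsum x hx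
    rw [e.deriv_eq]
    exact deriv_fun_add ((hfd.deriv isOpen_ball).differentiableAt (isOpen_ball.mem_nhds ht))
      (((by fun_prop : DifferentiableOn ℂ (fun t => t ^ m * h t) (ball 0 ρ)).deriv
        isOpen_ball).differentiableAt (isOpen_ball.mem_nhds ht))
  set Z : ℂ → ℂ := fun t =>
    2 * g t * (g t - 1) *
        (m ^ 2 * h t + (2 * m + 1) * t * deriv h t + t ^ 2 * deriv (deriv h) t) +
      2 * h t * (g t + f t - 1) * (t ^ 2 * deriv (deriv f) t + t * deriv f t) -
      ((3 * g t - 1) * (2 * (t * deriv f t) * (m * h t + t * deriv h t) +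
        t ^ m * (m * h t + t * deriv h t) ^ 2) + 3 * h t * (t * deriv f t) ^ 2 +
      l ^ 2 / 4 * h t * ((g t - 1) ^ 4 + (g t - 1) ^ 3 * (f t - 1) +
        (g t - 1) ^ 2 * (f t - 1) ^ 2 + (g t - 1) * (f t - 1) ^ 3 + (f t - 1) ^ 4 +
        2 * ((g t - 1) ^ 3 + (g t - 1) ^ 2 * (f t - 1) + (g t - 1) * (f t - 1) ^ 2 +
          (f t - 1) ^ 3)) -
      t ^ 2 * h t * (g t ^ 2 + g t * f t + f t ^ 2 + g t + f t)) with hZ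
  have hZc : ContinuousAt Z 0 := by
    have c1 := hf.continuousAt
    have c2 := hf.deriv.continuousAt
    have c3 := hf.deriv.deriv.continuousAt
    have c4 := hh.continuousAt
    have c5 := hh.deriv.continuousAt
    have c6 := hh.deriv.deriv.continuousAt
    have c7 := hg.continuousAt
    fun_prop
  have hZ0 : ∀ᶠ t in 𝓝[≠] 0, Z t = 0 := by
    filter_upwards [poly hf hf0 hfP, poly hg hg0 hgP, hgeq.filter_mono nhdsWithin_le_nhds,
      (hgeq.deriv).filter_mono nhdsWithin_le_nhds,
      (hgeq.deriv.deriv).filter_mono nhdsWithin_le_nhds,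
      nhdsWithin_le_nhds (ball_mem_nhds 0 hρ), self_mem_nhdsWithin] with t ef eg e0 e1 e2 hb ht
    have ht : t ≠ 0 := ht
    rw [hsum t hb] at e1
    rw [hsum' t hb] at e2
    have E1 := mul_deriv_pow_mul (hhd.differentiableAt (isOpen_ball.mem_nhds hb)) m
    have E2 := euler_sq_pow_mul isOpen_ball hhd hb m
    have d1 : t * deriv g t = t * deriv f t + t ^ m * (m * h t + t * deriv h t) := by
      rw [e1]; linear_combination E1
    have d2 : t ^ 2 * deriv (deriv g) t + t * deriv g t =
        t ^ 2 * deriv (deriv f) t + t * deriv f t + t ^ m *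
          (m ^ 2 * h t + (2 * m + 1) * t * deriv h t + t ^ 2 * deriv (deriv h) t) := by
      rw [e1, e2]; linear_combination E2
    rw [d2, d1] at eg
    have key : t ^ m * Z t = 0 := by
      simp only [hZ]
      have e0' : t ^ m * h t = g t - f t := by rw [e0]; ring
      linear_combination eg - ef + (2 * (g t + f t - 1) * (t ^ 2 * deriv (deriv f) t +
        t * deriv f t) - 3 * (t * deriv f t) ^ 2 - l ^ 2 / 4 * ((g t - 1) ^ 4 +
        (g t - 1) ^ 3 * (f t - 1) + (g t - 1) ^ 2 * (f t - 1) ^ 2 + (g t - 1) * (f t - 1) ^ 3 +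
        (f t - 1) ^ 4 + 2 * ((g t - 1) ^ 3 + (g t - 1) ^ 2 * (f t - 1) +
        (g t - 1) * (f t - 1) ^ 2 + (f t - 1) ^ 3)) +
        t ^ 2 * (g t ^ 2 + g t * f t + f t ^ 2 + g t + f t)) * e0'
    exact (mul_eq_zero.mp key).resolve_left (pow_ne_zero m ht)
  have hlim : Z 0 = 0 := tendsto_nhds_unique (hZc.mono_left nhdsWithin_le_nhds)
    (tendsto_const_nhds.congr' (hZ0.mono fun _ h => h.symm))
  have hm0 : m ≠ 0 := (Nat.zero_le l).trans_lt hlm |>.ne'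
  simp only [hZ, hf0, hg0] at hlim
  have hml : ((m : ℂ) ^ 2 - l ^ 2) * h 0 = 0 := by
    ring_nf at hlim
    simp [hm0] at hlim
    linear_combination hlim / 4
  have := sub_eq_zero.mp ((mul_eq_zero.mp hml).resolve_right hh0)
  have : m ^ 2 = l ^ 2 := by exact_mod_cast this
  exact hlm.ne' (Nat.pow_left_injective two_ne_zero this)

lemma natCast_le_analyticOrderAt_sub_iff {l : ℕ} (hl : 0 < l) {f : ℂ → ℂ} (hf : AnalyticAt ℂ f 0)
    (a : ℂ) :
    ((l + 1 : ℕ) : ℕ∞) ≤ analyticOrderAt (fun t => f t - (-1 + a * t ^ l)) 0 ↔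
      f 0 = -1 ∧ (∀ k, 0 < k → k < l → iteratedDeriv k f 0 = 0) ∧
        iteratedDeriv l f 0 = l.factorial * a := by
  have hk (k : ℕ) : iteratedDeriv k (fun t => f t - (-1 + a * t ^ l)) 0 =
      iteratedDeriv k f 0 - ((if k = 0 then -1 else 0) +
        a * if k = l then (l.factorial : ℂ) else 0) := by
    rw [iteratedDeriv_fun_sub hf.contDiffAt (by fun_prop),
      iteratedDeriv_fun_add (by fun_prop) (by fun_prop), iteratedDeriv_const,
      iteratedDeriv_const_mul_field, iteratedDeriv_fun_pow_zero]
    push_cast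
    rfl
  rw [natCast_le_analyticOrderAt_iff_iteratedDeriv_eq_zero (by fun_prop)]
  simp only [hk]
  constructor
  · intro h
    refine ⟨?_, fun k hk0 hkl => ?_, ?_⟩
    · simpa [hl.ne, add_eq_zero_iff_eq_neg] using h 0 l.succ_pos
    · simpa [hk0.ne', hkl.ne] using h k (hkl.trans l.lt_succ_self)
    · have := h l l.lt_succ_self
      simp only [hl.ne', if_true, if_false] at this
      linear_combination this
  · rintro ⟨h0, h1, h2⟩ k hkl
    rcases Nat.eq_zero_or_pos k with rfl | hk0
    · simp [h0, hl.ne]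
    rcases (Nat.lt_succ_iff.mp hkl).lt_or_eq with hlt | rfl
    · simp [h1 k hk0 hlt, hk0.ne', hlt.ne]
    · simp only [h2, hl.ne', if_true, if_false]
      ring

/-- Proposition 7.1: for `l ∈ ℤ₊` and P5 coefficients `α = l²/8`, `β = −l²/8`, `γ = 0`,
`δ = −1/2`, and any `a ∈ ℂ`, there is a unique solution of P5 holomorphic near `t = 0` whose
Taylor expansion has the form `y(t) = −1 + Σ_{k≥l} a_k t^k` with `a_l = a`. -/
theorem statement16 (l : ℕ) (hl : 0 < l) (a : ℂ) :
    ∃ (f : ℂ → ℂ) (r : ℝ), 0 < r ∧ AnalyticOnNhd ℂ f (ball 0 r) ∧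
      (∀ t ∈ ball (0 : ℂ) r, t ≠ 0 →
        P5at ((l : ℂ) ^ 2 / 8) (-(l : ℂ) ^ 2 / 8) 0 (-1 / 2) f t) ∧
      f 0 = -1 ∧
      (∀ k : ℕ, 0 < k → k < l → iteratedDeriv k f 0 = 0) ∧
      iteratedDeriv l f 0 = (l.factorial : ℂ) * a ∧
      ∀ (g : ℂ → ℂ) (r' : ℝ), 0 < r' → AnalyticOnNhd ℂ g (ball 0 r') →
        (∀ t ∈ ball (0 : ℂ) r', t ≠ 0 →
          P5at ((l : ℂ) ^ 2 / 8) (-(l : ℂ) ^ 2 / 8) 0 (-1 / 2) g t) →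
        g 0 = -1 →
        (∀ k : ℕ, 0 < k → k < l → iteratedDeriv k g 0 = 0) →
        iteratedDeriv l g 0 = (l.factorial : ℂ) * a →
        ∀ᶠ t in 𝓝 (0 : ℂ), g t = f t := by
  obtain ⟨r, hr, v, hv, hv0, hode⟩ := exists_trigonometric_ode_solution hl (-a / 2)
  obtain ⟨σ, hσ, hσ0, hsin⟩ := exists_sin_eq_mul
  have hz : DifferentiableOn ℂ (fun t => t ^ l * v t) (ball 0 r) := by fun_prop
  have hz0 : (0 : ℂ) ^ l * v 0 = 0 := by simp [hl.ne']
  have hs1 : ∀ t ∈ ball (0 : ℂ) r, Complex.sin (t ^ l * v t) - 1 ≠ 0 := fun t ht h =>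
    (hode t ht).1 (by
      have := Complex.sin_sq_add_cos_sq (t ^ l * v t)
      rw [sub_eq_zero.mp h] at this
      simpa using this)
  set f : ℂ → ℂ := fun t =>
    (Complex.sin (t ^ l * v t) + 1) / (Complex.sin (t ^ l * v t) - 1) with hf
  have hfd : DifferentiableOn ℂ f (ball 0 r) := (hz.csin.add_const 1).div (hz.csin.sub_const 1) hs1
  have hfa : AnalyticOnNhd ℂ f (ball 0 r) := hfd.analyticOnNhd isOpen_ball
  have hfP : ∀ t ∈ ball (0 : ℂ) r, t ≠ 0 →
      P5at ((l : ℂ) ^ 2 / 8) (-(l : ℂ) ^ 2 / 8) 0 (-1 / 2) f t := fun t ht ht0 =>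
    P5at_moebius_sin isOpen_ball hz (fun x hx => (hode x hx).1) ht ht0 (hode t ht).2
  have h0 : (0 : ℂ) ∈ ball (0 : ℂ) r := mem_ball_self hr
  have hva : AnalyticAt ℂ v 0 := hv.analyticOnNhd isOpen_ball 0 h0
  have hza : AnalyticAt ℂ (fun t => t ^ l * v t) 0 := by fun_prop
  have hford : ((l + 1 : ℕ) : ℕ∞) ≤ analyticOrderAt (fun t => f t - (-1 + a * t ^ l)) 0 := by
    have hσz : AnalyticAt ℂ (fun t => σ (t ^ l * v t)) 0 :=
      AnalyticAt.fun_comp (g := σ) (by rwa [hz0]) hza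
    have hsz : AnalyticAt ℂ (fun t => Complex.sin (t ^ l * v t) - 1) 0 := by fun_prop
    obtain ⟨W, hW, hW'⟩ := exists_eq_mul_of_apply_zero
      (φ := fun t => 2 * v t * σ (t ^ l * v t) / (Complex.sin (t ^ l * v t) - 1) - a)
      ((((analyticAt_const.mul hva).mul hσz).div hsz (hs1 0 h0)).sub analyticAt_const)
      (by simp [hl.ne', hσ0, hv0]; ring)
    have hfa0 := hfa 0 h0
    refine (natCast_le_analyticOrderAt (by fun_prop)).mpr ⟨W, hW, ?_⟩
    have hcont : Tendsto (fun t => t ^ l * v t) (𝓝 0) (𝓝 0) := by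
      simpa [ContinuousAt, hl.ne'] using hza.continuousAt
    filter_upwards [hW', hcont.eventually hsin, ball_mem_nhds 0 hr] with t e1 e2 ht
    have := hs1 t ht
    rw [sub_zero, smul_eq_mul, pow_succ, mul_assoc, ← e1, hf]
    field_simp
    linear_combination 2 * e2
  obtain ⟨hf0, hf1, hf2⟩ := (natCast_le_analyticOrderAt_sub_iff hl (hfa 0 h0) a).mp hford
  refine ⟨f, r, hr, hfa, hfP, hf0, hf1, hf2, fun g r' hr' hga hgP hg0 hg1 hg2 => ?_⟩
  have punct {y : ℂ → ℂ} {ρ : ℝ} (hρ : 0 < ρ) (hy : ∀ t ∈ ball (0 : ℂ) ρ, t ≠ 0 →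
      P5at ((l : ℂ) ^ 2 / 8) (-(l : ℂ) ^ 2 / 8) 0 (-1 / 2) y t) :
      ∀ᶠ t in 𝓝[≠] 0, P5at ((l : ℂ) ^ 2 / 8) (-(l : ℂ) ^ 2 / 8) 0 (-1 / 2) y t := by
    filter_upwards [nhdsWithin_le_nhds (ball_mem_nhds 0 hρ), self_mem_nhdsWithin] with t h1 h2
      using hy t h1 h2
  have hg := hga 0 (mem_ball_self hr')
  refine eventuallyEq_of_P5at (hfa 0 h0) hg (punct hr hfP) (punct hr' hgP) hf0 hg0 ?_
  have hgord := (natCast_le_analyticOrderAt_sub_iff hl hg a).mpr ⟨hg0, hg1, hg2⟩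
  have := (le_min hgord hford).trans le_analyticOrderAt_sub
  refine this.trans_eq (congrArg (analyticOrderAt · 0) ?_)
  ext t
  simp
end
end

section
/- Consider P5 with coefficients α̂ = 1/8, β̂ = −1/8, γ̂ = 0, δ̂ = −1/2, and for a ∈ ℂ let y(t) = −1 + Σ_{k=1}^∞ a_k t^k be the unique solution holomorphic near t = 0 with a_1 = a. Then for each k ≥ 1 the coefficient a_k is a polynomial function of a: a_k = P_k(a) where P_k is a polynomial with real coefficients, of degree k, with leading coefficient (−1/2)^{k−1} and vanishing coefficient of degree k−1; equivalently P_k(x) = (−1/2)^{k−1} x^k + O(x^{k−2}) as x → ∞. -/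
open Filter Topology Metric

noncomputable section

/-! ### Taylor series at the origin -/

/-- The formal Taylor series of `f` at the origin. -/
def taylorSeries (f : ℂ → ℂ) : PowerSeries ℂ :=
  PowerSeries.mk fun n => iteratedDeriv n f 0 / (n.factorial : ℂ)

lemma coeff_taylorSeries (f : ℂ → ℂ) (n : ℕ) :
    PowerSeries.coeff n (taylorSeries f) = iteratedDeriv n f 0 / (n.factorial : ℂ) := by
  simp [taylorSeries]

lemma taylorSeries_congr {f g : ℂ → ℂ} (h : f =ᶠ[𝓝 0] g) : taylorSeries f = taylorSeries g := by
  ext n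
  rw [coeff_taylorSeries, coeff_taylorSeries, h.iteratedDeriv_eq n]

/-- The function `f` is analytic at the origin with Taylor series `F`. -/
def HasTaylor (f : ℂ → ℂ) (F : PowerSeries ℂ) : Prop := AnalyticAt ℂ f 0 ∧ taylorSeries f = F

namespace HasTaylor

variable {f g : ℂ → ℂ} {F G : PowerSeries ℂ}

lemma add (hf : HasTaylor f F) (hg : HasTaylor g G) :
    HasTaylor (fun t => f t + g t) (F + G) := by
  obtain ⟨hf, rfl⟩ := hf
  obtain ⟨hg, rfl⟩ := hg
  refine ⟨by fun_prop, ?_⟩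
  ext n
  rw [map_add, coeff_taylorSeries, coeff_taylorSeries, coeff_taylorSeries,
    iteratedDeriv_fun_add hf.contDiffAt hg.contDiffAt, add_div]

lemma sub (hf : HasTaylor f F) (hg : HasTaylor g G) :
    HasTaylor (fun t => f t - g t) (F - G) := by
  obtain ⟨hf, rfl⟩ := hf
  obtain ⟨hg, rfl⟩ := hg
  refine ⟨by fun_prop, ?_⟩
  ext n
  rw [map_sub, coeff_taylorSeries, coeff_taylorSeries, coeff_taylorSeries,
    iteratedDeriv_fun_sub hf.contDiffAt hg.contDiffAt, sub_div]

lemma mul (hf : HasTaylor f F) (hg : HasTaylor g G) :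
    HasTaylor (fun t => f t * g t) (F * G) := by
  obtain ⟨hf, rfl⟩ := hf
  obtain ⟨hg, rfl⟩ := hg
  refine ⟨by fun_prop, ?_⟩
  ext n
  have h := iteratedDeriv_mul (n := n) hf.contDiffAt hg.contDiffAt
  rw [PowerSeries.coeff_mul, Finset.Nat.sum_antidiagonal_eq_sum_range_succ_mk, coeff_taylorSeries]
  change iteratedDeriv n (f * g) 0 / _ = _
  rw [h, Finset.sum_div]
  refine Finset.sum_congr rfl fun i hi => ?_
  have hi' : i ≤ n := Nat.lt_succ_iff.mp (Finset.mem_range.mp hi)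
  have h1 : (n.factorial : ℂ) ≠ 0 := mod_cast n.factorial_ne_zero
  have h2 : (i.factorial : ℂ) ≠ 0 := mod_cast i.factorial_ne_zero
  have h3 : ((n - i).factorial : ℂ) ≠ 0 := mod_cast (n - i).factorial_ne_zero
  have h4 : (n.choose i : ℂ) * i.factorial * (n - i).factorial = n.factorial := mod_cast
    Nat.choose_mul_factorial_mul_factorial hi'
  rw [coeff_taylorSeries, coeff_taylorSeries]
  field_simp
  rw [← h4]
  ring

lemma const (c : ℂ) : HasTaylor (fun _ => c) (PowerSeries.C c) := by
  refine ⟨analyticAt_const, ?_⟩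
  ext n
  rw [coeff_taylorSeries, iteratedDeriv_const, PowerSeries.coeff_C]
  split_ifs with h <;> simp [h]

lemma pow (hf : HasTaylor f F) (n : ℕ) : HasTaylor (fun t => f t ^ n) (F ^ n) := by
  induction n with
  | zero => simpa using const 1
  | succ n ih => simpa only [pow_succ] using ih.mul hf

lemma id : HasTaylor (fun t => t) PowerSeries.X := by
  refine ⟨analyticAt_id, ?_⟩
  ext n
  rw [coeff_taylorSeries, iteratedDeriv_fun_id, PowerSeries.coeff_X]
  rcases n with _ | _ | n <;> simp

lemma deriv (hf : HasTaylor f F) : HasTaylor (deriv f) (PowerSeries.derivative ℂ F) := by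
  obtain ⟨hf, rfl⟩ := hf
  refine ⟨hf.deriv, ?_⟩
  ext n
  rw [PowerSeries.coeff_derivative, coeff_taylorSeries, coeff_taylorSeries, iteratedDeriv_succ',
    Nat.factorial_succ]
  have h1 : (n.factorial : ℂ) ≠ 0 := mod_cast n.factorial_ne_zero
  have h2 : (n : ℂ) + 1 ≠ 0 := mod_cast n.succ_ne_zero
  push_cast
  field_simp

end HasTaylor

/-- The Euler operator `X · d/dX` on formal power series. -/
def euler (F : PowerSeries ℂ) : PowerSeries ℂ := PowerSeries.X * PowerSeries.derivative ℂ F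

lemma coeff_euler (F : PowerSeries ℂ) (n : ℕ) :
    PowerSeries.coeff n (euler F) = n * PowerSeries.coeff n F := by
  rcases n with _ | n
  · simp [euler]
  · rw [euler, PowerSeries.coeff_succ_X_mul, PowerSeries.coeff_derivative]
    push_cast
    ring

lemma euler_add (F G : PowerSeries ℂ) : euler (F + G) = euler F + euler G := by
  simp [euler, mul_add]

lemma euler_sub (F G : PowerSeries ℂ) : euler (F - G) = euler F - euler G := by
  simp [euler, mul_sub]

lemma euler_mul (F G : PowerSeries ℂ) : euler (F * G) = F * euler G + euler F * G := by
  simp only [euler, Derivation.leibniz, smul_eq_mul]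
  ring

lemma euler_one : euler 1 = 0 := by
  simp [euler]

/-- The Taylor series of a solution satisfies P5 with denominators cleared. -/
lemma taylorSeries_equation {f : ℂ → ℂ} {r : ℝ} (hr : 0 < r) (hf : AnalyticOnNhd ℂ f (ball 0 r))
    (hP : ∀ t ∈ ball (0 : ℂ) r, t ≠ 0 → P5at (1 / 8) (-1 / 8) 0 (-1 / 2) f t) (h0 : f 0 = -1) :
    let y := taylorSeries f
    8 * y * (y - 1) * euler (euler y) = 4 * (3 * y - 1) * euler y ^ 2 + (y - 1) ^ 4 * (y + 1)
      - 4 * PowerSeries.X ^ 2 * y ^ 2 * (y + 1) := by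
  intro y
  have hf0 : AnalyticAt ℂ f 0 := hf 0 (mem_ball_self hr)
  have hy0 : ∀ᶠ t in 𝓝 (0 : ℂ), f t ≠ 0 :=
    hf0.continuousAt.eventually_ne (by simp [h0])
  have hy1 : ∀ᶠ t in 𝓝 (0 : ℂ), f t ≠ 1 :=
    hf0.continuousAt.eventually_ne (by norm_num [h0])
  have key : (fun t => 8 * t ^ 2 * f t * (f t - 1) * deriv (deriv f) t
        + 8 * t * f t * (f t - 1) * deriv f t) =ᶠ[𝓝 0]
      (fun t => 4 * t ^ 2 * (3 * f t - 1) * deriv f t ^ 2 + (f t - 1) ^ 4 * (f t + 1)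
        - 4 * t ^ 2 * f t ^ 2 * (f t + 1)) := by
    filter_upwards [hy0, hy1, ball_mem_nhds (0 : ℂ) hr] with t h1 h2 ht
    rcases eq_or_ne t 0 with rfl | htne
    · simp [h0]
    · have h3 : f t - 1 ≠ 0 := sub_ne_zero.mpr h2
      have h := hP t ht htne
      unfold P5at at h
      rw [h]
      field_simp
      ring
  have c := HasTaylor.const
  have hX := HasTaylor.id
  have hy : HasTaylor f y := ⟨hf0, rfl⟩
  have hL := ((((((c 8).mul (hX.pow 2)).mul hy).mul (hy.sub (c 1))).mul hy.deriv.deriv).add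
    (((((c 8).mul hX).mul hy).mul (hy.sub (c 1))).mul hy.deriv)).2
  have hR := ((((((c 4).mul (hX.pow 2)).mul (((c 3).mul hy).sub (c 1))).mul (hy.deriv.pow 2)).add
    (((hy.sub (c 1)).pow 4).mul (hy.add (c 1)))).sub
    ((((c 4).mul (hX.pow 2)).mul (hy.pow 2)).mul (hy.add (c 1)))).2
  have hT := hL.symm.trans ((taylorSeries_congr key).trans hR)
  simp only [map_ofNat, map_one] at hT
  have he : euler (euler y) = PowerSeries.X ^ 2 * PowerSeries.derivative ℂ
      (PowerSeries.derivative ℂ y) + PowerSeries.X * PowerSeries.derivative ℂ y := by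
    simp only [euler, Derivation.leibniz, smul_eq_mul, PowerSeries.derivative_X]
    ring
  rw [he, euler]
  linear_combination hT

/-- The substitution `y = (v - 1) / (v + 1)` turns P5 into an equation odd in `v`. -/
lemma euler_equation_of_mobius {y v : PowerSeries ℂ} (hv : y * (1 + v) = v - 1)
    (hy : 8 * y * (y - 1) * euler (euler y) = 4 * (3 * y - 1) * euler y ^ 2
      + (y - 1) ^ 4 * (y + 1) - 4 * PowerSeries.X ^ 2 * y ^ 2 * (y + 1)) :
    (1 - v ^ 2) * euler (euler v) + v * euler v ^ 2 - v
      + PowerSeries.C (1 / 4) * PowerSeries.X ^ 2 * (v * (1 - v ^ 2) ^ 2) = 0 := by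
  have hs : v - 1 = y * (1 + v) := hv.symm
  have h1 : euler y * (1 + v) = euler v - y * euler v := by
    have h := congrArg euler hv
    rw [euler_mul, euler_add, euler_sub, euler_one] at h
    linear_combination h
  have h2 : euler (euler y) * (1 + v) = euler (euler v) - y * euler (euler v)
      - 2 * euler y * euler v := by
    have h := congrArg euler h1
    rw [euler_sub, euler_mul, euler_mul, euler_add, euler_one] at h
    linear_combination h
  have h3 : euler y * (1 + v) ^ 2 = 2 * euler v := by
    linear_combination (1 + v) * h1 - euler v * hv
  have h4 : euler (euler y) * (1 + v) ^ 3 = 2 * (1 + v) * euler (euler v) - 4 * euler v ^ 2 := by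
    linear_combination (1 + v) ^ 2 * h2 - 2 * euler v * h3 - (1 + v) * euler (euler v) * hv
  have h5 : 8 * (y * (1 + v)) * (y * (1 + v) - (1 + v)) * (euler (euler y) * (1 + v) ^ 3) =
      4 * (3 * (y * (1 + v)) - (1 + v)) * (euler y * (1 + v) ^ 2) ^ 2
        + (y * (1 + v) - (1 + v)) ^ 4 * (y * (1 + v) + (1 + v))
        - 4 * PowerSeries.X ^ 2 * (y * (1 + v)) ^ 2 * (y * (1 + v) + (1 + v)) * (1 + v) ^ 2 := by
    linear_combination (1 + v) ^ 5 * hy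
  rw [hv, h3, h4] at h5
  have h6 : PowerSeries.C (1 / 32 : ℂ) * 32 = 1 := by
    rw [← map_ofNat (PowerSeries.C (R := ℂ)) 32, ← map_mul]
    norm_num
  have h7 : PowerSeries.C (1 / 4 : ℂ) = PowerSeries.C (1 / 32 : ℂ) * 8 := by
    rw [← map_ofNat (PowerSeries.C (R := ℂ)) 8, ← map_mul]
    norm_num
  rw [h7]
  linear_combination PowerSeries.C (1 / 32 : ℂ) * h5
    - ((1 - v ^ 2) * euler (euler v) + v * euler v ^ 2 - v) * h6

/-! ### Families of numbers depending polynomially on a parameter -/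

section PolynomialFamilies

variable {ι : Type*} {a : ι → ℂ}

/-- The family `g` is a real polynomial of degree at most `d` in the parameter `a`
(and vanishes if `d < 0`). -/
def IsPolyLE (a : ι → ℂ) (d : ℤ) (g : ι → ℂ) : Prop :=
  ∃ Q : Polynomial ℝ, (∀ n : ℕ, d < n → Q.coeff n = 0) ∧ ∀ s, g s = Polynomial.aeval (a s) Q

namespace IsPolyLE

variable {d e : ℤ} {g h : ι → ℂ}

lemma zero : IsPolyLE a d fun _ => 0 :=
  ⟨0, by simp, by simp⟩

lemma mono (hg : IsPolyLE a d g) (hde : d ≤ e) : IsPolyLE a e g := by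
  obtain ⟨Q, hQ, hgQ⟩ := hg
  exact ⟨Q, fun n hn => hQ n (hde.trans_lt hn), hgQ⟩

lemma congr (hg : IsPolyLE a d g) (hgh : ∀ s, h s = g s) : IsPolyLE a d h := by
  rwa [funext hgh]

lemma add (hg : IsPolyLE a d g) (hh : IsPolyLE a d h) : IsPolyLE a d fun s => g s + h s := by
  obtain ⟨Q, hQ, hgQ⟩ := hg
  obtain ⟨R, hR, hhR⟩ := hh
  exact ⟨Q + R, fun n hn => by simp [hQ n hn, hR n hn], fun s => by simp [hgQ, hhR]⟩

lemma const_mul (c : ℝ) (hg : IsPolyLE a d g) : IsPolyLE a d fun s => (c : ℂ) * g s := by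
  obtain ⟨Q, hQ, hgQ⟩ := hg
  exact ⟨Polynomial.C c * Q, fun n hn => by simp [hQ n hn], fun s => by simp [hgQ]⟩

lemma mul (hg : IsPolyLE a d g) (hh : IsPolyLE a e h) :
    IsPolyLE a (d + e) fun s => g s * h s := by
  obtain ⟨Q, hQ, hgQ⟩ := hg
  obtain ⟨R, hR, hhR⟩ := hh
  refine ⟨Q * R, fun n hn => ?_, fun s => by simp [hgQ, hhR]⟩
  rw [Polynomial.coeff_mul]
  refine Finset.sum_eq_zero fun x hx => ?_
  have hx' : x.1 + x.2 = n := Finset.HasAntidiagonal.mem_antidiagonal.mp hx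
  rcases lt_or_ge d (x.1 : ℤ) with h1 | h1
  · rw [hQ _ h1, zero_mul]
  · rw [hR _ (by omega), mul_zero]

lemma sum {κ : Type*} (t : Finset κ) {G : κ → ι → ℂ} (hG : ∀ x ∈ t, IsPolyLE a d (G x)) :
    IsPolyLE a d fun s => ∑ x ∈ t, G x s := by
  classical
  induction t using Finset.induction_on with
  | empty => simpa using zero
  | insert x t hx ih =>
    simp only [Finset.sum_insert hx]
    exact (hG x (Finset.mem_insert_self x t)).add
      (ih fun z hz => hG z (Finset.mem_insert_of_mem hz))

lemma one (hd : 0 ≤ d) : IsPolyLE a d fun _ => 1 :=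
  ⟨1, fun n hn => by rw [Polynomial.coeff_one, if_neg (by omega)], by simp⟩

lemma param (hd : 1 ≤ d) : IsPolyLE a d a :=
  ⟨Polynomial.X, fun n hn => by rw [Polynomial.coeff_X, if_neg (by omega)], by simp⟩

lemma pow (hg : IsPolyLE a d g) (n : ℕ) : IsPolyLE a (n * d) fun s => g s ^ n := by
  induction n with
  | zero => simpa using one (a := a) le_rfl
  | succ n ih =>
    simp only [pow_succ]
    exact (ih.mul hg).mono (by push_cast; linarith)

end IsPolyLE

/-- For `k < N`, the `k`-th coefficient of the family `F` of power series is a real polynomial of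
degree at most `k - e` in the parameter `a`. -/
def CoeffLE (a : ι → ℂ) (e : ℤ) (N : ℕ) (F : ι → PowerSeries ℂ) : Prop :=
  ∀ k < N, IsPolyLE a (k - e) fun s => PowerSeries.coeff k (F s)

namespace CoeffLE

variable {e e' : ℤ} {N : ℕ} {F G : ι → PowerSeries ℂ}

lemma mono (hF : CoeffLE a e N F) (he : e' ≤ e) : CoeffLE a e' N F := fun k hk =>
  (hF k hk).mono (by omega)

lemma add (hF : CoeffLE a e N F) (hG : CoeffLE a e N G) :
    CoeffLE a e N fun s => F s + G s := fun k hk => by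
  simpa using (hF k hk).add (hG k hk)

lemma const_mul (c : ℝ) (hF : CoeffLE a e N F) :
    CoeffLE a e N fun s => PowerSeries.C (c : ℂ) * F s := fun k hk => by
  simpa using (hF k hk).const_mul c

lemma sub (hF : CoeffLE a e N F) (hG : CoeffLE a e N G) :
    CoeffLE a e N fun s => F s - G s := by
  simpa [sub_eq_add_neg] using hF.add (hG.const_mul (-1))

lemma euler (hF : CoeffLE a e N F) : CoeffLE a e N fun s => euler (F s) := fun k hk => by
  simpa [coeff_euler] using (hF k hk).const_mul k

lemma mul (hF : CoeffLE a e N F) (hG : CoeffLE a e' N G) :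
    CoeffLE a (e + e') N fun s => F s * G s := fun k hk => by
  simp only [PowerSeries.coeff_mul]
  refine IsPolyLE.sum _ fun x hx => ?_
  have hx' : x.1 + x.2 = k := Finset.HasAntidiagonal.mem_antidiagonal.mp hx
  exact ((hF x.1 (by omega)).mul (hG x.2 (by omega))).mono (by omega)

/-- The coefficient of index `N` of a product of series without constant term only involves
coefficients of smaller index. -/
lemma mul_succ (hF : CoeffLE a e N F) (hG : CoeffLE a e' N G)
    (hF0 : ∀ s, PowerSeries.constantCoeff (F s) = 0) (hG0 : ∀ s, PowerSeries.constantCoeff (G s) = 0) :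
    CoeffLE a (e + e') (N + 1) fun s => F s * G s := fun k hk => by
  simp only [PowerSeries.coeff_mul]
  refine IsPolyLE.sum _ fun x hx => ?_
  have hx' : x.1 + x.2 = k := Finset.HasAntidiagonal.mem_antidiagonal.mp hx
  rcases Nat.eq_zero_or_pos x.1 with h1 | h1
  · simpa only [h1, PowerSeries.coeff_zero_eq_constantCoeff_apply, hF0, zero_mul] using IsPolyLE.zero
  rcases Nat.eq_zero_or_pos x.2 with h2 | h2
  · simpa only [h2, PowerSeries.coeff_zero_eq_constantCoeff_apply, hG0, mul_zero] using IsPolyLE.zero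
  exact ((hF x.1 (by omega)).mul (hG x.2 (by omega))).mono (by omega)

lemma one : CoeffLE a 0 N fun _ => 1 := fun k _ => by
  simp only [PowerSeries.coeff_one]
  split_ifs
  · exact IsPolyLE.one (by omega)
  · exact IsPolyLE.zero

lemma X : CoeffLE a 1 N fun _ => PowerSeries.X := fun k _ => by
  simp only [PowerSeries.coeff_X]
  split_ifs
  · exact IsPolyLE.one (by omega)
  · exact IsPolyLE.zero

lemma half_param_mul_X : CoeffLE a 0 N fun s => PowerSeries.C (a s / 2) * PowerSeries.X := fun k _ => by
  simp only [PowerSeries.coeff_C_mul, PowerSeries.coeff_X, mul_ite, mul_one, mul_zero]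
  split_ifs
  · refine ((IsPolyLE.param (a := a) le_rfl).const_mul (1 / 2)).mono (by omega) |>.congr fun s => ?_
    push_cast
    ring
  · exact IsPolyLE.zero

lemma mk_neg_half_param_pow :
    CoeffLE a 0 N fun s => PowerSeries.mk fun k => (-a s / 2) ^ k := fun k _ => by
  simp only [PowerSeries.coeff_mk]
  refine (((IsPolyLE.param (a := a) le_rfl).const_mul (-1 / 2)).pow k).mono (by omega)
    |>.congr fun s => ?_
  push_cast
  ring

end CoeffLE

/-- Solutions `v = (a / 2) X + O(X²)` of the odd form of P5 agree with their linear part up to terms of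
filtration two. -/
lemma coeffLE_sub_linear {v : ι → PowerSeries ℂ}
    (hv : ∀ s, (1 - v s ^ 2) * euler (euler (v s)) + v s * euler (v s) ^ 2 - v s
      + PowerSeries.C (1 / 4) * PowerSeries.X ^ 2 * (v s * (1 - v s ^ 2) ^ 2) = 0)
    (h0 : ∀ s, PowerSeries.constantCoeff (v s) = 0) (h1 : ∀ s, PowerSeries.coeff 1 (v s) = a s / 2) (N : ℕ) :
    CoeffLE a 2 N fun s => v s - PowerSeries.C (a s / 2) * PowerSeries.X := by
  set z : ι → PowerSeries ℂ := fun s => v s - PowerSeries.C (a s / 2) * PowerSeries.X with hz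
  have hz0 (s : ι) : PowerSeries.constantCoeff (z s) = 0 := by simp [hz, h0]
  have hz1 (s : ι) : PowerSeries.coeff 1 (z s) = 0 := by simp [hz, h1]
  have hvz (s : ι) : v s = PowerSeries.C (a s / 2) * PowerSeries.X + z s := by simp [hz]
  have hl (s : ι) : euler (PowerSeries.C (a s / 2) * PowerSeries.X) =
      PowerSeries.C (a s / 2) * PowerSeries.X := by
    simp [euler, Derivation.leibniz, mul_comm]
  have hrec (s : ι) : euler (euler (z s)) - z s =
      v s * (PowerSeries.C (a s / 2) * PowerSeries.X * (z s + euler (euler (z s))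
          - PowerSeries.C ((2 : ℝ) : ℂ) * euler (z s)) + z s * euler (euler (z s))
          - euler (z s) * euler (z s))
        - PowerSeries.C ((1 / 4 : ℝ) : ℂ) * (PowerSeries.X * (PowerSeries.X
          * (v s * ((1 - v s * v s) * (1 - v s * v s))))) := by
    have h := hv s
    have e1 : euler (v s) = PowerSeries.C (a s / 2) * PowerSeries.X + euler (z s) := by
      rw [hvz s, euler_add, hl]
    have e2 : euler (euler (v s)) = PowerSeries.C (a s / 2) * PowerSeries.X + euler (euler (z s)) := by
      rw [e1, euler_add, hl]
    have e3 : PowerSeries.C ((2 : ℝ) : ℂ) = 2 := by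
      rw [Complex.ofReal_ofNat, map_ofNat]
    have e4 : PowerSeries.C ((1 / 4 : ℝ) : ℂ) = PowerSeries.C (1 / 4) := by simp
    rw [e2, e1] at h
    rw [e3, e4]
    have e5 := hvz s
    generalize PowerSeries.C (1 / 4 : ℂ) = c at *
    generalize PowerSeries.C (a s / 2) * PowerSeries.X = l at *
    generalize euler (euler (z s)) = z2 at *
    generalize euler (z s) = z1 at *
    linear_combination h + (1 + v s * (l + z2)) * e5
  have hez (s : ι) : PowerSeries.constantCoeff (euler (z s)) = 0 := by simp [euler]
  induction N with
  | zero => exact fun k hk => absurd hk (Nat.not_lt_zero k)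
  | succ N ih =>
    have hvN : CoeffLE a 0 N v := by
      have h := CoeffLE.half_param_mul_X.add (ih.mono (by norm_num : (0 : ℤ) ≤ 2))
      exact fun k hk => by simpa [← hvz] using h k hk
    have hw : CoeffLE a 2 N fun s => PowerSeries.C (a s / 2) * PowerSeries.X * (z s
        + euler (euler (z s)) - PowerSeries.C ((2 : ℝ) : ℂ) * euler (z s))
        + z s * euler (euler (z s)) - euler (z s) * euler (z s) :=
      (((CoeffLE.half_param_mul_X.mul ((ih.add ih.euler.euler).sub (ih.euler.const_mul 2))).mono
        (by norm_num)).add ((ih.mul ih.euler.euler).mono (by norm_num))).sub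
        ((ih.euler.mul ih.euler).mono (by norm_num))
    have hq : CoeffLE a 0 N fun s => 1 - v s * v s := CoeffLE.one.sub (hvN.mul hvN)
    have hA := hvN.mul_succ hw h0 (by simp [hez, hz0])
    have hB := (CoeffLE.X.mul_succ (CoeffLE.X.mul (hvN.mul (hq.mul hq))) (by simp)
      (by simp)).const_mul (1 / 4)
    have hAB := (hA.mono (by norm_num : (2 : ℤ) ≤ _)).sub (hB.mono (by norm_num : (2 : ℤ) ≤ _))
    intro k hk
    rcases k with _ | _ | k
    · simpa only [PowerSeries.coeff_zero_eq_constantCoeff_apply, hz0] using IsPolyLE.zero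
    · simpa only [zero_add, hz1] using IsPolyLE.zero
    · have h := (hAB (k + 2) hk).const_mul (((k + 2 : ℝ) ^ 2 - 1)⁻¹)
      have hne : ((k + 2 : ℂ) ^ 2 - 1) ≠ 0 := by
        have : ((k + 2 : ℂ) ^ 2 - 1) = ((k + 1) * (k + 3) : ℕ) := by push_cast; ring
        rw [this]
        exact Nat.cast_ne_zero.mpr (by positivity)
      simp only [← hrec, map_sub, coeff_euler] at h
      convert h using 2 with s
      push_cast
      field_simp

/-- The Möbius transform of such a solution agrees with that of its linear part up to terms of
filtration two. -/
lemma coeffLE_sub_geometric {v w : ι → PowerSeries ℂ}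
    (hz : ∀ N, CoeffLE a 2 N fun s => v s - PowerSeries.C (a s / 2) * PowerSeries.X)
    (hv0 : ∀ s, PowerSeries.constantCoeff (v s) = 0)
    (hw0 : ∀ s, PowerSeries.constantCoeff (w s) = 0)
    (hw : ∀ s, w s * (1 + v s) = 2 * v s) (N : ℕ) :
    CoeffLE a 2 N fun s => w s - PowerSeries.C ((2 : ℝ) : ℂ) * (PowerSeries.C (a s / 2)
      * PowerSeries.X * PowerSeries.mk fun k => (-a s / 2) ^ k) := by
  set g : ι → PowerSeries ℂ := fun s => PowerSeries.C ((2 : ℝ) : ℂ) * (PowerSeries.C (a s / 2)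
      * PowerSeries.X * PowerSeries.mk fun k => (-a s / 2) ^ k) with hg
  set z : ι → PowerSeries ℂ := fun s => v s - PowerSeries.C (a s / 2) * PowerSeries.X with hzdef
  have e3 : PowerSeries.C ((2 : ℝ) : ℂ) = 2 := by
    rw [Complex.ofReal_ofNat, map_ofNat]
  have hgeom (s : ι) : g s * (1 + PowerSeries.C (a s / 2) * PowerSeries.X) =
      2 * (PowerSeries.C (a s / 2) * PowerSeries.X) := by
    have h : (PowerSeries.mk fun k => (-a s / 2) ^ k)
        * (1 + PowerSeries.C (a s / 2) * PowerSeries.X) = 1 := by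
      ext n
      rw [mul_add, mul_one, ← mul_assoc, mul_comm _ (PowerSeries.C _), mul_assoc, map_add,
        PowerSeries.coeff_C_mul, PowerSeries.coeff_one]
      rcases n with _ | n
      · simp
      · rw [PowerSeries.coeff_succ_mul_X, PowerSeries.coeff_mk, PowerSeries.coeff_mk,
          if_neg n.succ_ne_zero]
        ring
    simp only [hg, e3]
    linear_combination 2 * (PowerSeries.C (a s / 2) * PowerSeries.X) * h
  have hz0 (s : ι) : PowerSeries.constantCoeff (z s) = 0 := by simp [hzdef, hv0]
  have hgA (N : ℕ) : CoeffLE a 0 N g :=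
    (CoeffLE.half_param_mul_X.mul CoeffLE.mk_neg_half_param_pow).const_mul 2
  have hrec (s : ι) : w s - g s = PowerSeries.C ((2 : ℝ) : ℂ) * z s - (g s * z s
      + (w s - g s) * z s) - PowerSeries.C (a s / 2) * PowerSeries.X * (w s - g s) := by
    rw [e3]
    have hvz : v s = PowerSeries.C (a s / 2) * PowerSeries.X + z s := by simp [hzdef]
    have h := hw s
    rw [hvz] at h
    linear_combination h - hgeom s
  induction N with
  | zero => exact fun k hk => absurd hk (Nat.not_lt_zero k)
  | succ N ih =>
    have h := (((hz (N + 1)).const_mul 2).sub ((((hgA (N + 1)).mul (hz (N + 1))).mono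
      (by norm_num : (2 : ℤ) ≤ _)).add ((ih.mul_succ (hz N) (by simp [hw0]) hz0).mono
      (by norm_num : (2 : ℤ) ≤ _)))).sub ((CoeffLE.half_param_mul_X.mul_succ ih (by simp)
      (by simp [hw0])).mono (by norm_num : (2 : ℤ) ≤ _))
    intro k hk
    exact (h k hk).congr fun s => congrArg _ (hrec s)

end PolynomialFamilies

/-- Statement 7.1 of the paper: for P5 with `α = 1/8`, `β = −1/8`, `γ = 0`, `δ = −1/2`, the `k`-th
Taylor coefficient at `0` of the holomorphic solution `y = −1 + a t + …` is a polynomial `P_k(a)`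
with real coefficients, of degree `k`, leading coefficient `(−1/2)^{k−1}`, and vanishing
coefficient in degree `k−1`. -/
theorem statement17 (k : ℕ) (hk : 1 ≤ k) :
    ∃ P : Polynomial ℝ,
      P.natDegree = k ∧
      P.coeff k = (-1 / 2 : ℝ) ^ (k - 1) ∧
      P.coeff (k - 1) = 0 ∧
      ∀ (a : ℂ) (f : ℂ → ℂ) (r : ℝ), 0 < r → AnalyticOnNhd ℂ f (ball 0 r) →
        (∀ t ∈ ball (0 : ℂ) r, t ≠ 0 →
          P5at (1 / 8) (-1 / 8) 0 (-1 / 2) f t) →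
        f 0 = -1 → deriv f 0 = a →
        iteratedDeriv k f 0 = (k.factorial : ℂ) * Polynomial.aeval a P := by
  let S := {f : ℂ → ℂ // ∃ r : ℝ, 0 < r ∧ AnalyticOnNhd ℂ f (ball 0 r) ∧
    (∀ t ∈ ball (0 : ℂ) r, t ≠ 0 → P5at (1 / 8) (-1 / 8) 0 (-1 / 2) f t) ∧ f 0 = -1}
  let α : S → ℂ := fun s => deriv s.1 0
  let y : S → PowerSeries ℂ := fun s => taylorSeries s.1
  let w : S → PowerSeries ℂ := fun s => y s + 1
  let v : S → PowerSeries ℂ := fun s => w s * (2 - w s)⁻¹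
  have hw0 (s : S) : PowerSeries.constantCoeff (w s) = 0 := by
    obtain ⟨f, r, hr, hf, hP, h0⟩ := s
    have h := coeff_taylorSeries f 0
    rw [PowerSeries.coeff_zero_eq_constantCoeff_apply] at h
    simp [w, y, h, h0]
  have hw1 (s : S) : PowerSeries.coeff 1 (w s) = α s := by
    simp [w, y, α, coeff_taylorSeries, PowerSeries.coeff_one]
  have h2 (s : S) : PowerSeries.constantCoeff (2 - w s) = 2 := by
    rw [map_sub, hw0, sub_zero, map_ofNat]
  have hvw (s : S) : v s * (2 - w s) = w s := by
    rw [mul_assoc, PowerSeries.inv_mul_cancel _ (by rw [h2]; norm_num), mul_one]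
  have hwv (s : S) : w s * (1 + v s) = 2 * v s := by
    linear_combination -hvw s
  have hv0 (s : S) : PowerSeries.constantCoeff (v s) = 0 := by simp [v, hw0]
  have hv1 (s : S) : PowerSeries.coeff 1 (v s) = α s / 2 := by
    have h := congrArg (PowerSeries.coeff 1) (hvw s)
    rw [PowerSeries.coeff_one_mul, hv0, h2, hw1] at h
    rw [← h]
    ring
  have hveq (s : S) : _ := euler_equation_of_mobius (y := y s) (v := v s)
    (by linear_combination hwv s) (by
      obtain ⟨f, r, hr, hf, hP, h0⟩ := s
      exact taylorSeries_equation hr hf hP h0)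
  obtain ⟨Q, hQ, hQw⟩ := coeffLE_sub_geometric (coeffLE_sub_linear hveq hv0 hv1) hv0 hw0 hwv
    (k + 1) k k.lt_succ_self
  obtain ⟨m, rfl⟩ : ∃ m, k = m + 1 := ⟨k - 1, by omega⟩
  have hQ1 : Q.coeff (m + 1) = 0 := hQ _ (by push_cast; omega)
  have hQ2 : Q.coeff m = 0 := hQ _ (by push_cast; omega)
  have hc : ((-1 / 2 : ℝ) ^ m) ≠ 0 := pow_ne_zero _ (by norm_num)
  refine ⟨Polynomial.C ((-1 / 2 : ℝ) ^ m) * Polynomial.X ^ (m + 1) + Q, ?_, ?_, ?_, ?_⟩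
  · refine Polynomial.natDegree_eq_of_le_of_coeff_ne_zero ?_ ?_
    · refine Polynomial.natDegree_le_iff_coeff_eq_zero.mpr fun n hn => ?_
      rw [Polynomial.coeff_add, Polynomial.coeff_C_mul_X_pow, if_neg (by omega),
        hQ n (by push_cast; omega), add_zero]
    · rw [Polynomial.coeff_add, Polynomial.coeff_C_mul_X_pow, if_pos rfl, hQ1, add_zero]
      exact hc
  · rw [Polynomial.coeff_add, Polynomial.coeff_C_mul_X_pow, if_pos rfl, hQ1, add_zero,
      Nat.add_sub_cancel]
  · rw [Nat.add_sub_cancel, Polynomial.coeff_add, Polynomial.coeff_C_mul_X_pow,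
      if_neg (by omega), hQ2, add_zero]
  · rintro a f r hr hf hP h0 rfl
    have h := hQw ⟨f, r, hr, hf, hP, h0⟩
    have hfac : ((m + 1).factorial : ℂ) ≠ 0 := mod_cast (m + 1).factorial_ne_zero
    simp only [w, y, α, map_sub, map_add, coeff_taylorSeries, PowerSeries.coeff_one,
      PowerSeries.coeff_C_mul, mul_assoc, PowerSeries.coeff_succ_X_mul, PowerSeries.coeff_mk,
      if_neg m.succ_ne_zero, add_zero] at h
    rw [sub_eq_iff_eq_add, div_eq_iff hfac] at h
    rw [h, mul_comm, map_add]
    congr 1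
    simp only [map_mul, map_pow, Polynomial.aeval_X, Polynomial.aeval_C]
    rw [Complex.coe_algebraMap]
    push_cast
    rw [neg_div, neg_div, neg_pow, neg_pow (1 / 2 : ℂ), div_pow, div_pow]
    ring
end
end

section
/- Let (y, z, u) be a solution of the IDS with parameters (Θ0, Θ1, Θ∞) on a domain where y ≠ 0, z ≠ 0 and all denominators below are nonzero. Set Θ̃∞ = Θ∞ + 2 and define: z̃ = −z − Θ0 − (Θ∞+1)·z / ( z − (1/y)(z + (Θ0+Θ1+Θ∞)/2) ) + t·z·(z + (Θ0+Θ1+Θ∞)/2) / ( y·( z − (1/y)(z + (Θ0+Θ1+Θ∞)/2) )² ); ỹ = (1/y)·((z̃ + Θ0)/z)·( (z + (Θ0+Θ1+Θ∞)/2) / (z̃ + (Θ0−Θ1+Θ̃∞)/2) ); ũ = u · z t² / ( (z̃ + Θ0)·( z − (1/y)(z + (Θ0+Θ1+Θ∞)/2) )² ). Then (ỹ, z̃, ũ) is a solution of the IDS with parameters (Θ0, Θ1, Θ̃∞) = (Θ0, Θ1, Θ∞ + 2). -/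
open Filter Topology

noncomputable section

/-- Pointwise equations (with differentiability) of the isomonodromy deformation system (IDS)
with parameters `T0, T1, Ti` (denoting `Θ₀, Θ₁, Θ∞`). -/
def IDSat (T0 T1 Ti : ℂ) (y z u : ℂ → ℂ) (t : ℂ) : Prop :=
  DifferentiableAt ℂ y t ∧ DifferentiableAt ℂ z t ∧ DifferentiableAt ℂ u t ∧
  t * deriv y t =
    t * y t - 2 * z t * (y t - 1) ^ 2 -
      (y t - 1) * ((T0 - T1 + Ti) / 2 * y t - (3 * T0 + T1 + Ti) / 2) ∧
  t * deriv z t =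
    y t * z t * (z t + (T0 - T1 + Ti) / 2) -
      (1 / y t) * (z t + T0) * (z t + (T0 + T1 + Ti) / 2) ∧
  t * deriv u t =
    u t * (-2 * z t - T0 + y t * (z t + (T0 - T1 + Ti) / 2) +
      (1 / y t) * (z t + (T0 + T1 + Ti) / 2))

/-- The system of `IDSat` at a point, with the derivatives `y'`, `z'`, `u'` given explicitly. -/
theorem IDSat.of_hasDerivAt {T0 T1 Ti : ℂ} {y z u : ℂ → ℂ} {t y' z' u' : ℂ}
    (hy : HasDerivAt y y' t) (hz : HasDerivAt z z' t) (hu : HasDerivAt u u' t)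
    (ey : t * y' = t * y t - 2 * z t * (y t - 1) ^ 2 -
      (y t - 1) * ((T0 - T1 + Ti) / 2 * y t - (3 * T0 + T1 + Ti) / 2))
    (ez : t * z' = y t * z t * (z t + (T0 - T1 + Ti) / 2) -
      (1 / y t) * (z t + T0) * (z t + (T0 + T1 + Ti) / 2))
    (eu : t * u' = u t * (-2 * z t - T0 + y t * (z t + (T0 - T1 + Ti) / 2) +
      (1 / y t) * (z t + (T0 + T1 + Ti) / 2))) :
    IDSat T0 T1 Ti y z u t := by
  refine ⟨hy.differentiableAt, hz.differentiableAt, hu.differentiableAt, ?_, ?_, ?_⟩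
  · rwa [hy.deriv]
  · rwa [hz.deriv]
  · rwa [hu.deriv]

/-- `IDSat` at a point depends only on the germs of the functions there. -/
theorem IDSat.congr {T0 T1 Ti : ℂ} {y z u Y Z U : ℂ → ℂ} {t : ℂ}
    (h : IDSat T0 T1 Ti Y Z U t) (hy : y =ᶠ[𝓝 t] Y) (hz : z =ᶠ[𝓝 t] Z) (hu : u =ᶠ[𝓝 t] U) :
    IDSat T0 T1 Ti y z u t := by
  obtain ⟨dY, dZ, dU, eY, eZ, eU⟩ := h
  refine ⟨hy.differentiableAt_iff.2 dY, hz.differentiableAt_iff.2 dZ,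
    hu.differentiableAt_iff.2 dU, ?_, ?_, ?_⟩
  · rwa [hy.deriv_eq, hy.eq_of_nhds, hz.eq_of_nhds]
  · rwa [hz.deriv_eq, hy.eq_of_nhds, hz.eq_of_nhds]
  · rwa [hu.deriv_eq, hy.eq_of_nhds, hz.eq_of_nhds, hu.eq_of_nhds]

/-- The Bäcklund transformation in reduced form. With `c = y z - z - b`, `b = (Θ₀+Θ₁+Θ∞)/2`, the
transformed functions are `N / (y M)`, `z N / c² - Θ₀` and `u t² y² / N`. -/
theorem IDSat.reduced_backlund {T0 T1 Ti : ℂ} {y z u c N M : ℂ → ℂ} {t : ℂ}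
    (hc : c = fun s => y s * z s - z s - (T0 + T1 + Ti) / 2)
    (hN : N = fun s => -c s ^ 2 - (Ti + 1) * (y s * c s) + s * (z s + (T0 + T1 + Ti) / 2) * y s)
    (hM : M = fun s => -c s ^ 2 - (Ti + 1) * c s + s * z s * y s)
    (h : IDSat T0 T1 Ti y z u t) (hy0 : y t ≠ 0) (hc0 : c t ≠ 0) (hN0 : N t ≠ 0)
    (hM0 : M t ≠ 0) :
    IDSat T0 T1 (Ti + 2) (fun s => N s / (y s * M s)) (fun s => z s * N s / c s ^ 2 - T0)
      (fun s => u s * s ^ 2 * y s ^ 2 / N s) t := by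
  obtain ⟨dy, dz, du, ey, ez, eu⟩ := h
  replace dy := dy.hasDerivAt
  replace dz := dz.hasDerivAt
  replace du := du.hasDerivAt
  generalize deriv y t = y' at *
  generalize deriv z t = z' at *
  generalize deriv u t = u' at *
  have ht : HasDerivAt (fun s : ℂ => s) 1 t := hasDerivAt_id' t
  obtain ⟨c', dc, ec⟩ : ∃ c', HasDerivAt c c' t ∧
      t * c' = t * y' * z t + (y t - 1) * (t * z') := by
    refine ⟨y' * z t + y t * z' - z', ?_, by ring⟩
    rw [hc]
    exact ((dy.mul dz).sub dz).sub_const _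
  obtain ⟨N', dN, eN⟩ : ∃ N', HasDerivAt N N' t ∧
      t * N' = -(2 * c t * (t * c')) - (Ti + 1) * (t * y' * c t + y t * (t * c')) +
        ((t * (z t + (T0 + T1 + Ti) / 2) + t * (t * z')) * y t +
          t * (z t + (T0 + T1 + Ti) / 2) * (t * y')) := by
    have h := ((dc.pow 2).neg.sub ((dy.mul dc).const_mul (Ti + 1))).add
      ((ht.mul (dz.add_const ((T0 + T1 + Ti) / 2))).mul dy)
    refine ⟨_, h.congr_of_eventuallyEq (.of_eq hN), ?_⟩
    simp only [Pi.mul_apply]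
    push_cast
    ring
  obtain ⟨M', dM, eM⟩ : ∃ M', HasDerivAt M M' t ∧
      t * M' = -(2 * c t * (t * c')) - (Ti + 1) * (t * c') +
        ((t * z t + t * (t * z')) * y t + t * z t * (t * y')) := by
    have h := ((dc.pow 2).neg.sub (dc.const_mul (Ti + 1))).add ((ht.mul dz).mul dy)
    refine ⟨_, h.congr_of_eventuallyEq (.of_eq hM), ?_⟩
    simp only [Pi.mul_apply]
    push_cast
    ring
  have hct : c t = y t * z t - z t - (T0 + T1 + Ti) / 2 := by rw [hc]
  have hNt : N t = -c t ^ 2 - (Ti + 1) * (y t * c t) + t * (z t + (T0 + T1 + Ti) / 2) * y t := by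
    rw [hN]
  have hMt : M t = -c t ^ 2 - (Ti + 1) * c t + t * z t * y t := by rw [hM]
  refine IDSat.of_hasDerivAt
    (dN.div (dy.mul dM) (mul_ne_zero hy0 hM0))
    (((dz.mul dN).div (dc.pow 2) (pow_ne_zero 2 hc0)).sub_const T0)
    (((du.mul (ht.pow 2)).mul (dy.pow 2)).div dN hN0) ?_ ?_ ?_
  all_goals
    try simp only [Pi.mul_apply, Pi.pow_apply]
    clear dc dN dM ht dy dz du hc hN hM
    generalize y t = Y at *
    generalize z t = Z at *
    generalize u t = U at *
    generalize c t = C at *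
    generalize N t = n at *
    generalize M t = m at *
    push_cast
    obtain rfl : T1 = 2 * (Y * Z - Z - C) - T0 - Ti := by linear_combination 2 * hct
  · calc _ = (t * N' * (Y * m) - n * (t * y' * m + Y * (t * M'))) / (Y * m) ^ 2 := by ring
      _ = _ := by
        rw [eN, eM, ec, ey, ez]
        field_simp
        subst hNt hMt
        ring
  · calc _ = ((t * z' * n + Z * (t * N')) * C ^ 2 - Z * n * (2 * C * (t * c'))) / (C ^ 2) ^ 2 := by
          ring
      _ = _ := by
        rw [eN, ec, ey, ez]
        field_simp
        subst hNt hMt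
        ring
  · calc _ = (((t * u' * t ^ 2 + U * (2 * t ^ 2)) * Y ^ 2 + U * t ^ 2 * (2 * Y * (t * y'))) * n -
          U * t ^ 2 * Y ^ 2 * (t * N')) / n ^ 2 := by
          ring
      _ = _ := by
        rw [eN, ec, ey, ez, eu]
        field_simp
        subst hNt hMt
        ring
/-- The Bäcklund transformation raising `Θ∞` by 2 (Theorem A.1, first transformation):
if `(y,z,u)` solves the IDS with parameters `(Θ₀,Θ₁,Θ∞)` on an open set where `y ≠ 0`, `z ≠ 0`
and all denominators are nonzero, then `(ỹ,z̃,ũ)` solves the IDS with parameters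
`(Θ₀,Θ₁,Θ∞+2)`. -/
theorem statement18 (T0 T1 Ti : ℂ) (S : Set ℂ) (hS : IsOpen S)
    (y z u : ℂ → ℂ)
    (zt yt ut : ℂ → ℂ)
    (hzt : zt = fun t =>
      -z t - T0 - (Ti + 1) * z t / (z t - (1 / y t) * (z t + (T0 + T1 + Ti) / 2)) +
        t * z t * (z t + (T0 + T1 + Ti) / 2) /
          (y t * (z t - (1 / y t) * (z t + (T0 + T1 + Ti) / 2)) ^ 2))
    (hyt : yt = fun t =>
      (1 / y t) * ((zt t + T0) / z t) *
        ((z t + (T0 + T1 + Ti) / 2) / (zt t + (T0 - T1 + (Ti + 2)) / 2)))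
    (hut : ut = fun t =>
      u t * (z t * t ^ 2 /
        ((zt t + T0) * (z t - (1 / y t) * (z t + (T0 + T1 + Ti) / 2)) ^ 2)))
    (hsol : ∀ t ∈ S, IDSat T0 T1 Ti y z u t)
    (hy : ∀ t ∈ S, y t ≠ 0) (hz : ∀ t ∈ S, z t ≠ 0)
    (hden1 : ∀ t ∈ S, z t - (1 / y t) * (z t + (T0 + T1 + Ti) / 2) ≠ 0)
    (hden2 : ∀ t ∈ S, zt t + (T0 - T1 + (Ti + 2)) / 2 ≠ 0)
    (hden3 : ∀ t ∈ S, zt t + T0 ≠ 0) :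
    ∀ t ∈ S, IDSat T0 T1 (Ti + 2) yt zt ut t := by
  have reduce : ∀ t ∈ S,
      let b := (T0 + T1 + Ti) / 2
      let c := y t * z t - z t - b
      let N := -c ^ 2 - (Ti + 1) * (y t * c) + t * (z t + b) * y t
      let M := -c ^ 2 - (Ti + 1) * c + t * z t * y t
      c ≠ 0 ∧ N ≠ 0 ∧ M ≠ 0 ∧ zt t = z t * N / c ^ 2 - T0 ∧ yt t = N / (y t * M) ∧
        ut t = u t * t ^ 2 * y t ^ 2 / N := by
    intro t ht b c N M
    have hy0 := hy t ht
    have hz0 := hz t ht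
    have hw : z t - 1 / y t * (z t + b) = c / y t := by
      simp only [c]; field_simp; ring
    have hc0 : c ≠ 0 := by
      intro h
      exact hden1 t ht (by rw [hw, h, zero_div])
    have hzt' : zt t = z t * N / c ^ 2 - T0 := by
      have : zt t = -z t - T0 - (Ti + 1) * z t / (c / y t) +
          t * z t * (z t + b) / (y t * (c / y t) ^ 2) := by
        rw [← hw, hzt]
      rw [this]
      simp only [N]
      field_simp
      ring
    have h3 : zt t + T0 = z t * N / c ^ 2 := by rw [hzt']; ring
    have h2 : zt t + (T0 - T1 + (Ti + 2)) / 2 = (z t + b) * M / c ^ 2 := by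
      rw [hzt']
      field_simp
      simp only [N, M, c, b]
      ring
    have hN0 : N ≠ 0 := by
      intro h
      exact hden3 t ht (by rw [h3, h, mul_zero, zero_div])
    have hM0 : M ≠ 0 := by
      intro h
      exact hden2 t ht (by rw [h2, h, mul_zero, zero_div])
    have hp0 : z t + b ≠ 0 := by
      intro h
      exact hden2 t ht (by rw [h2, h, zero_mul, zero_div])
    refine ⟨hc0, hN0, hM0, hzt', ?_, ?_⟩
    · have : yt t = 1 / y t * ((z t * N / c ^ 2) / z t) *
          ((z t + b) / ((z t + b) * M / c ^ 2)) := by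
        rw [← h2, ← h3, hyt]
      rw [this]
      field_simp
    · have : ut t = u t * (z t * t ^ 2 / ((z t * N / c ^ 2) * (c / y t) ^ 2)) := by
        rw [← h3, ← hw, hut]
      rw [this]
      field_simp
  intro t ht
  have hS' : ∀ᶠ s in 𝓝 t, s ∈ S := hS.mem_nhds ht
  obtain ⟨hc0, hN0, hM0, -⟩ := reduce t ht
  refine (IDSat.reduced_backlund rfl rfl rfl (hsol t ht) (hy t ht) hc0 hN0 hM0).congr ?_ ?_ ?_
  · exact hS'.mono fun s hs => (reduce s hs).2.2.2.2.1
  · exact hS'.mono fun s hs => (reduce s hs).2.2.2.1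
  · exact hS'.mono fun s hs => (reduce s hs).2.2.2.2.2
end
end
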